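/- arXiv:quant-ph/9703022 — 5 statements merged into one kernel-verified Lean document; each statement's English description precedes it below -/
import Mathlib

section
/- For every n ≥ 1, there is a winning play of the pebble game of length 2^n − 1 that uses at most n pebbles. -/
/-- A single legal move of the pebble game on nodes `1,…,T`: a pebble is put on or
removed from a node `i ∈ {1,…,T}`, subject to the rule that if `i > 1` then node
`i - 1` must carry a pebble at the time. -/
def PebbleStep (T : ℕ) (Q R : Finset ℕ) : Prop :=
  ∃ i : ℕ, 1 ≤ i ∧ i ≤ T ∧ (1 < i → i - 1 ∈ Q) ∧
    ((i ∉ Q ∧ R = insert i Q) ∨ (i ∈ Q ∧ R = Q.erase i))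

/-- A play of the pebble game of length `T`: a finite sequence of positions
`P_0, P_1, …, P_L` starting from the empty position `P_0 = ∅`, each next position
obtained from the previous one by a legal move. -/
def IsPlay (T : ℕ) (P : List (Finset ℕ)) : Prop :=
  P.head? = some ∅ ∧ List.Chain' (PebbleStep T) P

/-- The play uses at most `n` pebbles: every position has at most `n` pebbles on the board. -/
def UsesAtMost (n : ℕ) (P : List (Finset ℕ)) : Prop :=
  ∀ Q ∈ P, Q.card ≤ n

/-- The play is winning: node `T` is pebbled at some time and the final position is empty. -/
def IsWinning (T : ℕ) (P : List (Finset ℕ)) : Prop :=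
  (∃ Q ∈ P, T ∈ Q) ∧ P.getLast? = some ∅


/-- A legal move between positions carrying at most `n` pebbles each. -/
def BoundedStep (T n : ℕ) (Q R : Finset ℕ) : Prop :=
  PebbleStep T Q R ∧ Q.card ≤ n ∧ R.card ≤ n

theorem PebbleStep.symm {T : ℕ} {Q R : Finset ℕ} (h : PebbleStep T Q R) : PebbleStep T R Q := by
  obtain ⟨i, h1, hT, hpred, ⟨hi, rfl⟩ | ⟨hi, rfl⟩⟩ := h
  · exact ⟨i, h1, hT, fun h => Finset.mem_insert_of_mem (hpred h),
      Or.inr ⟨Finset.mem_insert_self _ _, (Finset.erase_insert hi).symm⟩⟩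
  · exact ⟨i, h1, hT, fun h => Finset.mem_erase.2 ⟨by omega, hpred h⟩,
      Or.inl ⟨Finset.notMem_erase _ _, (Finset.insert_erase hi).symm⟩⟩

theorem PebbleStep.mono {T T' : ℕ} (hT : T ≤ T') {Q R : Finset ℕ} (h : PebbleStep T Q R) :
    PebbleStep T' Q R := by
  obtain ⟨i, h1, hi, h⟩ := h
  exact ⟨i, h1, hi.trans hT, h⟩

theorem PebbleStep.insert_of_lt {T m : ℕ} (hm : T < m) {Q R : Finset ℕ} (h : PebbleStep T Q R) :
    PebbleStep T (insert m Q) (insert m R) := by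
  obtain ⟨i, h1, hT, hpred, h⟩ := h
  have him : i ≠ m := by omega
  refine ⟨i, h1, hT, fun h => Finset.mem_insert_of_mem (hpred h), ?_⟩
  obtain ⟨hi, rfl⟩ | ⟨hi, rfl⟩ := h
  · exact Or.inl ⟨by simp [him, hi], Finset.insert_comm _ _ _⟩
  · exact Or.inr ⟨Finset.mem_insert_of_mem hi, (Finset.erase_insert_of_ne him.symm).symm⟩

theorem PebbleStep.insert_map_add {T : ℕ} (m : ℕ) {Q R : Finset ℕ} (h : PebbleStep T Q R) :
    PebbleStep (T + m) (insert m (Q.map (addRightEmbedding m)))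
      (insert m (R.map (addRightEmbedding m))) := by
  obtain ⟨i, h1, hT, hpred, h⟩ := h
  refine ⟨i + m, by omega, by omega, fun _ => ?_, ?_⟩
  · obtain rfl | hi := h1.eq_or_lt
    · simp
    · have hshift : i + m - 1 = addRightEmbedding m (i - 1) := by
        simp only [addRightEmbedding_apply]
        omega
      rw [hshift]
      exact Finset.mem_insert_of_mem (Finset.mem_map_of_mem _ (hpred hi))
  · have him : m ≠ i + m := by omega
    obtain ⟨hi, rfl⟩ | ⟨hi, rfl⟩ := h
    · refine Or.inl ⟨by simp [hi]; omega, ?_⟩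
      rw [Finset.map_insert, Finset.insert_comm, addRightEmbedding_apply]
    · refine Or.inr ⟨by simp [hi], ?_⟩
      rw [Finset.map_erase, addRightEmbedding_apply, Finset.erase_insert_of_ne him]

/-- With `n` pebbles one can reach a position from which node `2 ^ n` may be pebbled. -/
theorem exists_reflTransGen_boundedStep (n : ℕ) :
    ∃ Q : Finset ℕ, Q.card ≤ n ∧ (1 < 2 ^ n → 2 ^ n - 1 ∈ Q) ∧
      Relation.ReflTransGen (BoundedStep (2 ^ n - 1) n) ∅ Q := by
  induction n with
  | zero => exact ⟨∅, by simp, by simp, .refl⟩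
  | succ n ih =>
    obtain ⟨Q, hcard, hmem, hQ⟩ := ih
    have hpos : 1 ≤ 2 ^ n := Nat.one_le_two_pow
    have hT : 2 ^ (n + 1) - 1 = 2 ^ n - 1 + 2 ^ n := by
      rw [pow_succ]
      omega
    have hle : 2 ^ n - 1 ≤ 2 ^ (n + 1) - 1 := by omega
    have hins (m : ℕ) {A : Finset ℕ} (hA : A.card ≤ n) : (insert m A).card ≤ n + 1 :=
      (Finset.card_insert_le _ _).trans (by omega)
    refine ⟨insert (2 ^ n) (Q.map (addRightEmbedding (2 ^ n))), hins _ (by simpa), fun _ => ?_, ?_⟩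
    · rw [hT]
      obtain h | h := hpos.eq_or_lt
      · simp [← h]
      · exact Finset.mem_insert_of_mem (Finset.mem_map_of_mem (addRightEmbedding (2 ^ n)) (hmem h))
    · have reach : Relation.ReflTransGen (BoundedStep (2 ^ (n + 1) - 1) (n + 1)) ∅ Q :=
        Relation.ReflTransGen.mono (fun A B h =>
          ⟨h.1.mono hle, h.2.1.trans n.le_succ, h.2.2.trans n.le_succ⟩) _ _ hQ
      have place : Relation.ReflTransGen (BoundedStep (2 ^ (n + 1) - 1) (n + 1)) Q
          (insert (2 ^ n) Q) := by
        by_cases h : 2 ^ n ∈ Q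
        · rw [Finset.insert_eq_of_mem h]
        · exact .single ⟨⟨2 ^ n, hpos, by omega, hmem, Or.inl ⟨h, rfl⟩⟩,
            hcard.trans n.le_succ, hins _ hcard⟩
      have clear : Relation.ReflTransGen (BoundedStep (2 ^ (n + 1) - 1) (n + 1))
          (insert (2 ^ n) Q) (insert (2 ^ n) ∅) :=
        hQ.swap.lift (insert (2 ^ n)) fun A B h =>
          ⟨(h.1.symm.insert_of_lt (by omega)).mono hle, hins _ h.2.2, hins _ h.2.1⟩
      have shift : Relation.ReflTransGen (BoundedStep (2 ^ (n + 1) - 1) (n + 1))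
          (insert (2 ^ n) ∅) (insert (2 ^ n) (Q.map (addRightEmbedding (2 ^ n)))) :=
        hQ.lift (fun A => insert (2 ^ n) (A.map (addRightEmbedding (2 ^ n)))) fun A B h =>
          ⟨hT ▸ h.1.insert_map_add (2 ^ n), hins _ (by simpa using h.2.1),
            hins _ (by simpa using h.2.2)⟩
      exact ((reach.trans place).trans clear).trans shift

/-- A sequence of bounded moves from `A` to `B` can be prepended to a list of positions
starting at `B`. -/
theorem exists_list_of_reflTransGen_boundedStep {T n : ℕ} {A B : Finset ℕ}
    (h : Relation.ReflTransGen (BoundedStep T n) A B) {P : List (Finset ℕ)}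
    (hhead : P.head? = some B) (hchain : List.IsChain (PebbleStep T) P) (hcard : UsesAtMost n P) :
    ∃ P' : List (Finset ℕ), P'.head? = some A ∧ List.IsChain (PebbleStep T) P' ∧
      UsesAtMost n P' ∧ P'.getLast? = P.getLast? ∧ P ⊆ P' := by
  induction h using Relation.ReflTransGen.head_induction_on with
  | refl => exact ⟨P, hhead, hchain, hcard, rfl, List.Subset.refl _⟩
  | @head A C hAC _ ih =>
    obtain ⟨P', hhead', hchain', hcard', hlast, hsub⟩ := ih
    refine ⟨A :: P', rfl, ?_, ?_, ?_, List.subset_cons_of_subset _ hsub⟩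
    · refine List.isChain_cons.2 ⟨fun D hD => ?_, hchain'⟩
      obtain rfl : C = D := by simpa [hhead'] using hD
      exact hAC.1
    · exact List.forall_mem_cons.2 ⟨hAC.2.1, hcard'⟩
    · rw [← hlast]
      cases P' with
      | nil => simp at hhead'
      | cons => exact List.getLast?_cons_cons

/-- For every `n ≥ 1`, there is a winning play of the pebble game of length `2^n - 1`
that uses at most `n` pebbles. -/
theorem winning_play_with_n_pebbles (n : ℕ) (hn : 1 ≤ n) :
    ∃ P : List (Finset ℕ),
      IsPlay (2 ^ n - 1) P ∧ UsesAtMost n P ∧ IsWinning (2 ^ n - 1) P := by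
  obtain ⟨Q, -, hmem, hQ⟩ := exists_reflTransGen_boundedStep n
  have hback : Relation.ReflTransGen (BoundedStep (2 ^ n - 1) n) Q ∅ :=
    Relation.ReflTransGen.mono (fun A B h => ⟨h.1.symm, h.2.2, h.2.1⟩) _ _ hQ.swap
  obtain ⟨P₁, hhead₁, hchain₁, hcard₁, hlast₁, -⟩ :=
    exists_list_of_reflTransGen_boundedStep hback (P := [∅]) rfl (List.isChain_singleton _)
      (by simp [UsesAtMost])
  obtain ⟨P, hhead, hchain, hcard, hlast, hsub⟩ :=
    exists_list_of_reflTransGen_boundedStep hQ hhead₁ hchain₁ hcard₁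
  exact ⟨P, ⟨hhead, hchain⟩, hcard,
    ⟨Q, hsub (List.mem_of_mem_head? hhead₁), hmem (Nat.one_lt_two_pow (by omega))⟩,
    hlast.trans hlast₁⟩
end

section
/- For every n ≥ 1, there is a winning play of the pebble game of length 2^n − 1 that uses at most n pebbles and consists of at most 3^n − 1 moves (i.e., the play P_0,…,P_L has L ≤ 3^n − 1). -/
/-- `PebblePath T n a Q R`: there is a sequence of `a` legal moves leading from `Q` to `R`
between positions with at most `n` pebbles. -/
inductive PebblePath (T n : ℕ) : ℕ → Finset ℕ → Finset ℕ → Prop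
  | refl (Q : Finset ℕ) : PebblePath T n 0 Q Q
  | cons {a : ℕ} {Q R S : Finset ℕ} : PebbleStep T Q R → Q.card ≤ n → R.card ≤ n →
      PebblePath T n a R S → PebblePath T n (a + 1) Q S

theorem PebbleStep.insert_succ {T T' : ℕ} {Q R : Finset ℕ} (hT' : T ≤ T')
    (h : PebbleStep T Q R) : PebbleStep T' (insert (T + 1) Q) (insert (T + 1) R) := by
  obtain ⟨i, h1, hT, hp, h⟩ := h
  have hne : i ≠ T + 1 := by omega
  refine ⟨i, h1, hT.trans hT', fun h => Finset.mem_insert_of_mem (hp h), ?_⟩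
  obtain ⟨hi, rfl⟩ | ⟨hi, rfl⟩ := h
  · exact .inl ⟨by simp [hi, hne], Finset.insert_comm _ _ _⟩
  · exact .inr ⟨by simp [hi], (Finset.erase_insert_of_ne hne.symm).symm⟩

theorem PebbleStep.shift {T T' s : ℕ} {Q R : Finset ℕ} (hT' : T + s ≤ T')
    (h : PebbleStep T Q R) :
    PebbleStep T' (insert s (Q.map (addRightEmbedding s)))
      (insert s (R.map (addRightEmbedding s))) := by
  obtain ⟨i, h1, hT, hp, h⟩ := h
  have hne : i + s ≠ s := by omega
  refine ⟨i + s, by omega, by omega, fun _ => ?_, ?_⟩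
  · rcases h1.eq_or_lt with rfl | h1
    · simp
    · refine Finset.mem_insert_of_mem (Finset.mem_map.2 ⟨i - 1, hp h1, ?_⟩)
      simp only [addRightEmbedding_apply]
      omega
  · obtain ⟨hi, rfl⟩ | ⟨hi, rfl⟩ := h
    · refine .inl ⟨by simp [hi]; omega, ?_⟩
      rw [Finset.map_insert, Finset.insert_comm, addRightEmbedding_apply]
    · refine .inr ⟨by simp [hi], ?_⟩
      rw [Finset.map_erase, addRightEmbedding_apply, Finset.erase_insert_of_ne hne.symm]

namespace PebblePath

variable {T n a b : ℕ} {Q R S : Finset ℕ}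

theorem trans (h : PebblePath T n a Q R) (h' : PebblePath T n b R S) :
    PebblePath T n (a + b) Q S := by
  induction h with
  | refl => simpa using h'
  | cons hs hQ hR _ ih =>
    rw [Nat.add_right_comm]
    exact .cons hs hQ hR (ih h')

theorem symm (h : PebblePath T n a Q R) : PebblePath T n a R Q := by
  induction h with
  | refl => exact .refl _
  | cons hs hQ hR _ ih => exact ih.trans (.cons hs.symm hR hQ (.refl _))

/-- A map of positions that turns legal moves into legal moves and adds at most one pebble
turns paths into paths. -/
theorem map {T' : ℕ} (f : Finset ℕ → Finset ℕ)
    (hf : ∀ Q R, PebbleStep T Q R → PebbleStep T' (f Q) (f R))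
    (hcard : ∀ Q, (f Q).card ≤ Q.card + 1) (h : PebblePath T n a Q R) :
    PebblePath T' (n + 1) a (f Q) (f R) := by
  induction h with
  | refl => exact .refl _
  | cons hs hQ hR _ ih =>
    exact .cons (hf _ _ hs) ((hcard _).trans (by omega)) ((hcard _).trans (by omega)) ih

theorem mono {T' n' : ℕ} (hT : T ≤ T') (hn : n ≤ n') (h : PebblePath T n a Q R) :
    PebblePath T' n' a Q R := by
  induction h with
  | refl => exact .refl _
  | cons hs hQ hR _ ih =>
    obtain ⟨i, h1, hi, h⟩ := hs
    exact .cons ⟨i, h1, hi.trans hT, h⟩ (hQ.trans hn) (hR.trans hn) ih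

theorem card_right_le (h : PebblePath T n a Q R) (hQ : Q.card ≤ n) : R.card ≤ n := by
  induction h with
  | refl => exact hQ
  | cons _ _ hR _ ih => exact ih hR

/-- A path from `Q` to `R` can be prepended to a list of positions starting at `R`. -/
theorem exists_list (h : PebblePath T n a Q R) (l : List (Finset ℕ))
    (hhead : l.head? = some R) (hchain : l.IsChain (PebbleStep T)) (hcard : UsesAtMost n l) :
    ∃ l' : List (Finset ℕ), l'.head? = some Q ∧ l'.IsChain (PebbleStep T) ∧ UsesAtMost n l' ∧
      l'.length = a + l.length ∧ l'.getLast? = l.getLast? ∧ R ∈ l' := by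
  induction h with
  | refl => exact ⟨l, hhead, hchain, hcard, by simp, rfl, List.mem_of_mem_head? hhead⟩
  | @cons a Q R S hs hQ hR _ ih =>
    obtain ⟨l', h1, h2, h3, h4, h5, h6⟩ := ih hhead
    have hne : l' ≠ [] := List.ne_nil_of_mem h6
    refine ⟨Q :: l', rfl, ?_, ?_, ?_, ?_, List.mem_cons_of_mem _ h6⟩
    · exact List.isChain_cons.2 ⟨fun y hy => by simp_all, h2⟩
    · exact List.forall_mem_cons.2 ⟨hQ, h3⟩
    · simp only [List.length_cons, h4]
      omega
    · rw [← h5, List.getLast?_cons_of_ne_nil hne]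

end PebblePath

/-- With `n` pebbles, node `2 ^ n - 1` can be reached in at most `(3 ^ n - 1) / 2` moves. -/
theorem exists_pebblePath (n : ℕ) :
    ∃ (a : ℕ) (Q : Finset ℕ), PebblePath (2 ^ n - 1) n a ∅ Q ∧
      (0 < 2 ^ n - 1 → 2 ^ n - 1 ∈ Q) ∧ 2 * a + 1 ≤ 3 ^ n := by
  induction n with
  | zero => exact ⟨0, ∅, .refl _, by simp, by simp⟩
  | succ n ih =>
    obtain ⟨a, Q, hpath, hmem, ha⟩ := ih
    have hT : 2 ^ (n + 1) - 1 = (2 ^ n - 1) + (2 ^ n - 1 + 1) := by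
      have := Nat.one_le_two_pow (n := n)
      omega
    rw [hT]
    generalize 2 ^ n - 1 = m at *
    have hQ : Q.card ≤ n := hpath.card_right_le (by simp)
    have hreach := hpath.mono (T' := m + (m + 1)) (by omega) (Nat.le_succ n)
    have hclear : PebblePath (m + (m + 1)) (n + 1) a (insert (m + 1) Q) (insert (m + 1) ∅) :=
      hpath.symm.map _ (fun _ _ => PebbleStep.insert_succ (by omega))
        (fun _ => Finset.card_insert_le _ _)
    have hshift : PebblePath (m + (m + 1)) (n + 1) a (insert (m + 1) ∅)
        (insert (m + 1) (Q.map (addRightEmbedding (m + 1)))) :=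
      hpath.map (fun Q => insert (m + 1) (Q.map (addRightEmbedding (m + 1))))
        (fun _ _ => PebbleStep.shift le_rfl)
        (fun _ => (Finset.card_insert_le _ _).trans (by simp))
    have hplace : ∃ b ≤ 1, PebblePath (m + (m + 1)) (n + 1) b Q (insert (m + 1) Q) := by
      by_cases hmQ : m + 1 ∈ Q
      · exact ⟨0, by omega, by simpa [hmQ] using .refl Q⟩
      · exact ⟨1, le_rfl, .cons
          ⟨m + 1, by omega, by omega, fun h => hmem (by omega), .inl ⟨hmQ, rfl⟩⟩
          (by omega) ((Finset.card_insert_le _ _).trans (by omega)) (.refl _)⟩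
    obtain ⟨b, hb, hplace⟩ := hplace
    refine ⟨_, _, hreach.trans (hplace.trans (hclear.trans hshift)), fun _ => ?_, ?_⟩
    · rcases m.eq_zero_or_pos with rfl | hm
      · simp
      · exact Finset.mem_insert_of_mem (Finset.mem_map.2 ⟨m, hmem hm, rfl⟩)
    · rw [pow_succ]
      omega

/-- For every `n ≥ 1`, there is a winning play of the pebble game of length `2^n - 1`
that uses at most `n` pebbles and consists of at most `3^n - 1` moves (a play
`P_0, …, P_L`, i.e. a list of `L + 1` positions, has `L = P.length - 1` moves). -/
theorem winning_play_with_n_pebbles_and_few_moves (n : ℕ) (hn : 1 ≤ n) :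
    ∃ P : List (Finset ℕ),
      IsPlay (2 ^ n - 1) P ∧ UsesAtMost n P ∧ IsWinning (2 ^ n - 1) P ∧
      P.length - 1 ≤ 3 ^ n - 1 := by
  obtain ⟨a, Q, hpath, hmem, ha⟩ := exists_pebblePath n
  have hpos : 0 < 2 ^ n - 1 := Nat.sub_pos_of_lt (Nat.one_lt_two_pow (by omega))
  obtain ⟨l, h1, h2, h3, h4, h5, -⟩ :=
    hpath.symm.exists_list [∅] rfl (List.isChain_singleton _) (by simp [UsesAtMost])
  obtain ⟨P, p1, p2, p3, p4, p5, p6⟩ := hpath.exists_list l h1 h2 h3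
  refine ⟨P, ⟨p1, p2⟩, p3, ⟨⟨Q, p6, hmem hpos⟩, by simp [p5, h5]⟩, ?_⟩
  simp only [List.length_singleton] at h4
  omega
end

section
/- For every n ≥ 1, the pebble game of length 2^n − 1 can be won using at most n pebbles, but there is no winning play using at most n − 1 pebbles. -/
namespace PebbleGame

/-- A legal move on the nodes `b+1,…,T`, where `b` counts as permanently pebbled, with at most
`n` pebbles on the board before and after. -/
def Move (b T n : ℕ) (Q R : Finset ℕ) : Prop :=
  Q.card ≤ n ∧ R.card ≤ n ∧ ∃ i, b ≤ i ∧ i < T ∧ i ∈ insert b Q ∧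
    ((i + 1 ∉ Q ∧ R = insert (i + 1) Q) ∨ (i + 1 ∈ Q ∧ R = Q.erase (i + 1)))

/-- Reachability through moves on `b+1,…,T` with at most `n` pebbles. -/
abbrev Reach (b T n : ℕ) : Finset ℕ → Finset ℕ → Prop :=
  Relation.ReflTransGen (Move b T n)

lemma pebbleStep_iff {T : ℕ} {Q R : Finset ℕ} :
    PebbleStep T Q R ↔ ∃ i, 0 ≤ i ∧ i < T ∧ i ∈ insert 0 Q ∧
      ((i + 1 ∉ Q ∧ R = insert (i + 1) Q) ∨ (i + 1 ∈ Q ∧ R = Q.erase (i + 1))) := by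
  constructor
  · rintro ⟨i, h1, hT, hi, h⟩
    obtain ⟨j, rfl⟩ : ∃ j, i = j + 1 := ⟨i - 1, by omega⟩
    refine ⟨j, by omega, by omega, ?_, h⟩
    rcases Nat.eq_zero_or_pos j with rfl | hj
    · simp
    · exact Finset.mem_insert_of_mem (hi (by omega))
  · rintro ⟨i, -, hT, hi, h⟩
    refine ⟨i + 1, by omega, by omega, fun h1 => ?_, h⟩
    rcases Finset.mem_insert.1 hi with rfl | hi
    · omega
    · exact hi

lemma Move.symm {b T n : ℕ} {Q R : Finset ℕ} (h : Move b T n Q R) : Move b T n R Q := by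
  obtain ⟨hQ, hR, i, hb, hT, hi, h⟩ := h
  refine ⟨hR, hQ, i, hb, hT, ?_, ?_⟩
  · rcases h with ⟨_, rfl⟩ | ⟨_, rfl⟩ <;> grind
  · rcases h with ⟨h, rfl⟩ | ⟨h, rfl⟩
    · right; simp [h]
    · left; simp [h]

lemma Reach.symm {b T n : ℕ} {Q R : Finset ℕ} (h : Reach b T n Q R) : Reach b T n R Q := by
  have : Std.Symm (Move b T n) := ⟨fun _ _ => Move.symm⟩
  exact Std.Symm.symm _ _ h

lemma Reach.mono {b T T' n n' : ℕ} (hT : T ≤ T') (hn : n ≤ n') {Q R : Finset ℕ}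
    (h : Reach b T n Q R) : Reach b T' n' Q R := by
  refine Relation.ReflTransGen.mono ?_ _ _ h
  rintro Q R ⟨hQ, hR, i, hb, hi, h⟩
  exact ⟨hQ.trans hn, hR.trans hn, i, hb, hi.trans_le hT, h⟩

lemma Reach.card_le {b T n : ℕ} {Q : Finset ℕ} (h : Reach b T n ∅ Q) : Q.card ≤ n := by
  induction h with
  | refl => simp
  | tail _ h _ => exact h.2.1

/-- An additional pebble on a node `m` outside the playing field does not disturb the play. -/
lemma Reach.insert {b b' T T' n m : ℕ} (hT : T' ≤ T) (hb : b ≤ b') (hm : m ≤ b' ∨ T' < m)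
    (hbm : b' = b ∨ b' = m) {Q R : Finset ℕ} (h : Reach b' T' n Q R) :
    Reach b T (n + 1) (insert m Q) (insert m R) := by
  refine Relation.ReflTransGen.lift (Insert.insert m) ?_ _ _ h
  rintro Q R ⟨hQ, hR, i, hb', hi, hiQ, h⟩
  refine ⟨(Finset.card_insert_le _ _).trans (by omega),
    (Finset.card_insert_le _ _).trans (by omega), i, by omega, by omega, by grind, ?_⟩
  have hne : i + 1 ≠ m := by omega
  rcases h with ⟨h, rfl⟩ | ⟨h, rfl⟩
  · left
    exact ⟨by grind, Finset.insert_comm _ _ _⟩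
  · right
    exact ⟨by grind, (Finset.erase_insert_of_ne hne.symm).symm⟩

theorem exists_reach (n b : ℕ) :
    ∃ Q, Reach b (b + 2 ^ n - 1) n ∅ Q ∧ b + 2 ^ n - 1 ∈ insert b Q := by
  induction n generalizing b with
  | zero => exact ⟨∅, .refl, by simp⟩
  | succ n ih =>
    obtain ⟨Q₁, h₁, hm₁⟩ := ih b
    obtain ⟨Q₂, h₂, hm₂⟩ := ih (b + 2 ^ n)
    have hpos : 0 < 2 ^ n := by positivity
    have hsucc : b + 2 ^ (n + 1) - 1 = b + 2 ^ n + 2 ^ n - 1 := by rw [pow_succ]; omega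
    rw [hsucc]
    refine ⟨insert (b + 2 ^ n) Q₂, ?_, Finset.mem_insert_of_mem hm₂⟩
    have hplace : Reach b (b + 2 ^ n + 2 ^ n - 1) (n + 1) Q₁ (insert (b + 2 ^ n) Q₁) := by
      by_cases hmem : b + 2 ^ n ∈ Q₁
      · rw [Finset.insert_eq_of_mem hmem]
      · refine .single ⟨h₁.card_le.trans (by omega),
          (Finset.card_insert_le _ _).trans (by have := h₁.card_le; omega),
          b + 2 ^ n - 1, by omega, by omega, hm₁, ?_⟩
        rw [Nat.sub_add_cancel (by omega)]
        exact .inl ⟨hmem, rfl⟩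
    exact ((h₁.mono (by omega) (by omega)).trans hplace).trans
      ((h₁.symm.insert (by omega) le_rfl (by omega) (.inl rfl)).trans
        (h₂.insert le_rfl (by omega) (.inl le_rfl) (.inr rfl)))

/-- If `m` cannot be pebbled using `n` pebbles, then a position reachable with `n + 1` pebbles
that covers a node beyond `m` also covers a node up to `m`. -/
lemma low_nonempty {b T n m : ℕ} (hbm : b < m)
    (hm : ∀ Q, Reach b T n ∅ Q → m ∉ Q) {Q : Finset ℕ} (h : Reach b T (n + 1) ∅ Q)
    (hQ : (Q.filter (m < ·)).Nonempty) : (Q.filter (· ≤ m)).Nonempty := by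
  by_contra hlow
  rw [Finset.not_nonempty_iff_eq_empty] at hlow
  have key : ∀ R, Reach b T (n + 1) Q R →
      (R.filter (m < ·)).Nonempty ∧ Reach b T n ∅ (R.filter (· ≤ m)) := by
    intro R hR
    induction hR with
    | refl => exact ⟨hQ, hlow ▸ .refl⟩
    | @tail R S _ hRS ih =>
      obtain ⟨hne, hreach⟩ := ih
      obtain ⟨hRc, hSc, i, hb, hT, hi, hRS⟩ := hRS
      rcases Nat.lt_or_ge i m with him | him
      · have hhigh : S.filter (m < ·) = R.filter (m < ·) := by
          rcases hRS with ⟨_, rfl⟩ | ⟨_, rfl⟩ <;> (ext j; grind)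
        have hneS : (S.filter (m < ·)).Nonempty := hhigh ▸ hne
        refine ⟨hneS, hreach.tail ⟨hreach.card_le, ?_, i, hb, hT, by grind, ?_⟩⟩
        · have hlt : (S.filter (· ≤ m)).card < S.card := by
            obtain ⟨j, hj⟩ := hneS
            refine Finset.card_lt_card (Finset.filter_ssubset.2 ⟨j, ?_⟩)
            simpa using hj
          omega
        · rcases hRS with ⟨h, rfl⟩ | ⟨h, rfl⟩
          · left; exact ⟨by grind, by ext j; grind⟩
          · right; exact ⟨by grind, by ext j; grind⟩
      · have hlowS : S.filter (· ≤ m) = R.filter (· ≤ m) := by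
          rcases hRS with ⟨_, rfl⟩ | ⟨_, rfl⟩ <;> (ext j; grind)
        refine ⟨?_, hlowS ▸ hreach⟩
        have hmR := hm _ hreach
        have hiR : i ∈ R.filter (m < ·) := by
          have hmem : i ∈ R := Finset.mem_of_mem_insert_of_ne hi (by omega)
          have hne : i ≠ m := by
            rintro rfl
            exact hmR (by simp [hmem])
          exact Finset.mem_filter.2 ⟨hmem, by omega⟩
        refine ⟨i, ?_⟩
        rcases hRS with ⟨_, rfl⟩ | ⟨_, rfl⟩ <;> grind
  simpa using (key ∅ h.symm).1

theorem lt_of_reach (n : ℕ) {b T : ℕ} {Q : Finset ℕ} (h : Reach b T n ∅ Q) :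
    ∀ i ∈ Q, i < b + 2 ^ n := by
  induction n generalizing b Q with
  | zero =>
    have := h.card_le
    simp_all
  | succ n ih =>
    have hpos : 0 < 2 ^ n := by positivity
    have hsucc : b + 2 ^ (n + 1) = b + 2 ^ n + 2 ^ n := by rw [pow_succ]; omega
    obtain ⟨m, hm⟩ : ∃ m, m = b + 2 ^ n := ⟨_, rfl⟩
    have hmem : ∀ R, Reach b T n ∅ R → m ∉ R := fun R hR hmR => by
      have := ih hR m hmR
      omega
    have hcard : ∀ R, Reach b T (n + 1) ∅ R → (R.filter (m < ·)).card ≤ n := by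
      intro R hR
      rcases (R.filter (m < ·)).eq_empty_or_nonempty with he | hne
      · simp [he]
      · obtain ⟨j, hj⟩ := low_nonempty (by omega) hmem hR hne
        have hlt : (R.filter (m < ·)).card < R.card := by
          refine Finset.card_lt_card (Finset.filter_ssubset.2 ⟨j, ?_⟩)
          simpa using hj
        have := hR.card_le
        omega
    have hhigh : Reach m T n ∅ (Q.filter (m < ·)) := by
      induction h with
      | refl => exact .refl
      | @tail R S hR hRS ih =>
        have hS := hR.tail hRS
        obtain ⟨-, -, i, hb, hT, hi, hRS⟩ := hRS
        rcases Nat.lt_or_ge i m with him | him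
        · have heq : S.filter (m < ·) = R.filter (m < ·) := by
            rcases hRS with ⟨_, rfl⟩ | ⟨_, rfl⟩ <;> (ext j; grind)
          exact heq ▸ ih
        · have hiR : i ∈ insert m (R.filter (m < ·)) := by
            rcases Nat.eq_or_lt_of_le him with rfl | him
            · exact Finset.mem_insert_self _ _
            · have hmem : i ∈ R := Finset.mem_of_mem_insert_of_ne hi (by omega)
              exact Finset.mem_insert_of_mem (Finset.mem_filter.2 ⟨hmem, him⟩)
          refine ih.tail ⟨hcard R hR, hcard S hS, i, him, hT, hiR, ?_⟩
          rcases hRS with ⟨h, rfl⟩ | ⟨h, rfl⟩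
          · left; exact ⟨by grind, by rw [Finset.filter_insert, if_pos (by omega)]⟩
          · right; exact ⟨by grind, by ext j; grind⟩
    intro i hi
    rcases Nat.lt_or_ge m i with him | him
    · have := ih hhigh i (by simp [hi, him])
      omega
    · omega

lemma reach_of_mem_play {T n : ℕ} {A : Finset ℕ} {P : List (Finset ℕ)}
    (hchain : List.IsChain (PebbleStep T) (A :: P)) (hcard : UsesAtMost n (A :: P)) :
    ∀ Q ∈ A :: P, Reach 0 T n A Q := by
  induction P generalizing A with
  | nil => simp [Relation.ReflTransGen.refl]
  | cons B P ih =>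
    rw [List.isChain_cons_cons] at hchain
    intro Q hQ
    rcases List.mem_cons.1 hQ with rfl | hQ
    · exact .refl
    · exact .head ⟨hcard A (by simp), hcard B (by simp), pebbleStep_iff.1 hchain.1⟩
        (ih hchain.2 (fun R hR => hcard R (List.mem_cons_of_mem _ hR)) Q hQ)

/-- A play from `B` can be extended at its front by a path leading to `B`. -/
lemma exists_play_of_reach {T n : ℕ} {A B : Finset ℕ} (h : Reach 0 T n A B)
    {P : List (Finset ℕ)} (hchain : List.IsChain (PebbleStep T) (B :: P))
    (hcard : UsesAtMost n (B :: P)) :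
    ∃ P', List.IsChain (PebbleStep T) (A :: P') ∧ UsesAtMost n (A :: P') ∧
      (B :: P) <:+ (A :: P') := by
  induction h using Relation.ReflTransGen.head_induction_on with
  | refl => exact ⟨P, hchain, hcard, List.suffix_rfl⟩
  | @head A C hAC _ ih =>
    obtain ⟨P', hc, hu, hs⟩ := ih
    refine ⟨C :: P', hc.cons_cons (pebbleStep_iff.2 hAC.2.2), ?_,
      hs.trans (List.suffix_cons _ _)⟩
    intro R hR
    rcases List.mem_cons.1 hR with rfl | hR
    · exact hAC.1
    · exact hu R hR

end PebbleGame

/-- For every `n ≥ 1`, the pebble game of length `2^n - 1` can be won using at most `n`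
pebbles, but there is no winning play using at most `n - 1` pebbles. -/
theorem pebble_game_tight_bound (n : ℕ) (hn : 1 ≤ n) :
    (∃ P : List (Finset ℕ),
        IsPlay (2 ^ n - 1) P ∧ UsesAtMost n P ∧ IsWinning (2 ^ n - 1) P) ∧
    ¬ ∃ P : List (Finset ℕ),
        IsPlay (2 ^ n - 1) P ∧ UsesAtMost (n - 1) P ∧ IsWinning (2 ^ n - 1) P := by
  obtain ⟨k, rfl⟩ : ∃ k, n = k + 1 := ⟨n - 1, by omega⟩
  have hpos : 0 < 2 ^ k := by positivity
  have hsucc : 2 ^ (k + 1) = 2 ^ k + 2 ^ k := by rw [pow_succ]; omega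
  constructor
  · obtain ⟨Q, hQ, hmem⟩ := PebbleGame.exists_reach (k + 1) 0
    rw [zero_add] at hQ hmem
    have hTQ : 2 ^ (k + 1) - 1 ∈ Q := by
      rcases Finset.mem_insert.1 hmem with h | h
      · omega
      · exact h
    obtain ⟨P₁, hc₁, hu₁, hs₁⟩ := PebbleGame.exists_play_of_reach hQ.symm (P := [])
      (List.isChain_singleton _) (by simp [UsesAtMost])
    obtain ⟨P₂, hc₂, hu₂, hs₂⟩ := PebbleGame.exists_play_of_reach hQ hc₁ hu₁
    refine ⟨∅ :: P₂, ⟨rfl, hc₂⟩, hu₂, ⟨Q, hs₂.subset (by simp), hTQ⟩, ?_⟩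
    obtain ⟨l, hl⟩ := hs₁.trans hs₂
    rw [← hl]
    simp
  · rintro ⟨P, ⟨hhead, hchain⟩, hcard, ⟨Q, hQP, hTQ⟩, -⟩
    obtain ⟨P', rfl⟩ := List.head?_eq_some_iff.1 hhead
    have := PebbleGame.lt_of_reach _ (PebbleGame.reach_of_mem_play hchain hcard Q hQP) _ hTQ
    rw [Nat.add_sub_cancel] at this
    omega
end

section
/- If a winning play for the pebble game of length T exists using at most n pebbles and at most m erasure-moves, then for every T' ≤ T a winning play for the pebble game of length T' exists using at most n pebbles and at most m erasure-moves (deleting from the play all moves involving nodes larger than T' yields a legal winning play on the shorter board). -/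
/-- A single legal move of the pebble game with erasures on nodes `1,…,T`: a pebble is
put on or removed from a node `i ∈ {1,…,T}`; an addition of node `i` with `i > 1`
requires node `i - 1` to be pebbled, while removals are always allowed. -/
def PebbleStepE (T : ℕ) (Q R : Finset ℕ) : Prop :=
  ∃ i : ℕ, 1 ≤ i ∧ i ≤ T ∧
    ((i ∉ Q ∧ (1 < i → i - 1 ∈ Q) ∧ R = insert i Q) ∨ (i ∈ Q ∧ R = Q.erase i))

/-- The move from position `Q` to position `R` is an erasure-move: it removes a pebble
from a node `i > 1` while node `i - 1` is not pebbled. -/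
def IsErasureMove (Q R : Finset ℕ) : Prop :=
  ∃ i : ℕ, 1 < i ∧ i ∈ Q ∧ i - 1 ∉ Q ∧ R = Q.erase i

/-- A play of the pebble game with erasures of length `T`: a finite sequence of positions
`P_0, P_1, …, P_L` starting from the empty position `P_0 = ∅`, each next position
obtained from the previous one by a legal move. -/
def IsPlayE (T : ℕ) (P : List (Finset ℕ)) : Prop :=
  P.head? = some ∅ ∧ List.Chain' (PebbleStepE T) P

/-- The number of erasure-moves made in the play `P_0, …, P_L`. -/
noncomputable def erasureCount (P : List (Finset ℕ)) : ℕ :=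
  {j : ℕ | j + 1 < P.length ∧ IsErasureMove (P.getD j ∅) (P.getD (j + 1) ∅)}.ncard

/-- The play is winning: node `T` is pebbled at some time and the final position is empty. -/
def IsWinningE (T : ℕ) (P : List (Finset ℕ)) : Prop :=
  (∃ Q ∈ P, T ∈ Q) ∧ P.getLast? = some ∅

/-- The erasure count of a play splits off its first move. -/
theorem erasureCount_cons_cons (Q R : Finset ℕ) (L : List (Finset ℕ))
    [Decidable (IsErasureMove Q R)] :
    erasureCount (Q :: R :: L) =
      (if IsErasureMove Q R then 1 else 0) + erasureCount (R :: L) := by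
  set S : Set ℕ := {j : ℕ | j + 1 < (R :: L).length ∧
    IsErasureMove ((R :: L).getD j ∅) ((R :: L).getD (j + 1) ∅)} with hS
  have hfin : S.Finite := (Set.finite_lt_nat (R :: L).length).subset fun j hj => by
    have := hj.1
    simp only [Set.mem_ofPred_eq]
    omega
  have hsucc : (Nat.succ '' S).ncard = S.ncard :=
    Set.ncard_image_of_injective _ Nat.succ_injective
  have hcount : erasureCount (R :: L) = S.ncard := rfl
  rw [hcount, ← hsucc, erasureCount]
  split_ifs with h
  · rw [add_comm, ← Set.ncard_insert_of_notMem (a := 0) (by simp) (hfin.image _)]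
    congr 1
    ext j
    cases j <;> simp [hS, h]
  · rw [zero_add]
    congr 1
    ext j
    cases j <;> simp [hS, h]

/-- Restricting a legal move to the nodes up to `T'` either changes nothing or gives a legal
move on the board of length `T'`, which is an erasure-move only if the original move is. -/
theorem PebbleStepE.filter_le {T T' : ℕ} {Q R : Finset ℕ} (h : PebbleStepE T Q R) :
    Q.filter (· ≤ T') = R.filter (· ≤ T') ∨
      (PebbleStepE T' (Q.filter (· ≤ T')) (R.filter (· ≤ T')) ∧
        (IsErasureMove (Q.filter (· ≤ T')) (R.filter (· ≤ T')) → IsErasureMove Q R)) := by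
  obtain ⟨i, h1, -, h⟩ := h
  by_cases hi : i ≤ T'
  · right
    rcases h with ⟨hiQ, hpred, rfl⟩ | ⟨hiQ, rfl⟩
    · refine ⟨⟨i, h1, hi, .inl ⟨by simp [hiQ], fun h => ?_, ?_⟩⟩, ?_⟩
      · simp only [Finset.mem_filter]
        exact ⟨hpred h, by omega⟩
      · rw [Finset.filter_insert, if_pos hi]
      · rintro ⟨k, -, -, -, hk⟩
        have : i ∈ (insert i Q).filter (· ≤ T') := by simp [hi]
        rw [hk] at this
        simp [hiQ] at this
    · refine ⟨⟨i, h1, hi, .inr ⟨by simp [hiQ, hi], Finset.filter_erase _ _ _⟩⟩, ?_⟩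
      rintro ⟨k, hk1, hkQ, hkpred, hk⟩
      have hki : k = i := by
        by_contra hne
        have : k ∈ (Q.erase i).filter (· ≤ T') := by
          simp only [Finset.mem_filter, Finset.mem_erase] at hkQ ⊢
          exact ⟨⟨hne, hkQ.1⟩, hkQ.2⟩
        simp [hk] at this
      subst hki
      refine ⟨k, hk1, hiQ, fun hmem => hkpred ?_, rfl⟩
      simp only [Finset.mem_filter]
      exact ⟨hmem, by omega⟩
  · left
    rcases h with ⟨-, -, rfl⟩ | ⟨-, rfl⟩
    · rw [Finset.filter_insert, if_neg hi]
    · ext k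
      simp only [Finset.mem_filter, Finset.mem_erase]
      constructor
      · rintro ⟨hk, hle⟩
        exact ⟨⟨by omega, hk⟩, hle⟩
      · rintro ⟨⟨-, hk⟩, hle⟩
        exact ⟨hk, hle⟩

/-- Deleting from a sequence of legal moves all moves on nodes larger than `T'` gives a sequence
of legal moves on the board of length `T'` with no more erasure-moves. -/
theorem exists_isChain_filter_le {T : ℕ} (T' : ℕ) (L : List (Finset ℕ)) (Q : Finset ℕ)
    (h : List.IsChain (PebbleStepE T) (Q :: L)) :
    ∃ L' : List (Finset ℕ),
      List.IsChain (PebbleStepE T') (Q.filter (· ≤ T') :: L') ∧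
      (∀ R, R ∈ Q.filter (· ≤ T') :: L' ↔ ∃ S ∈ Q :: L, S.filter (· ≤ T') = R) ∧
      (Q.filter (· ≤ T') :: L').getLast? = (Q :: L).getLast?.map (Finset.filter (· ≤ T')) ∧
      erasureCount (Q.filter (· ≤ T') :: L') ≤ erasureCount (Q :: L) := by
  classical
  induction L generalizing Q with
  | nil => exact ⟨[], by simp, by simp [eq_comm], by simp, by simp [erasureCount]⟩
  | cons R L ih =>
    rw [List.isChain_cons_cons] at h
    obtain ⟨L', hchain, hmem, hlast, hcount⟩ := ih R h.2
    rcases h.1.filter_le (T' := T') with heq | ⟨hstep, herase⟩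
    · rw [heq]
      refine ⟨L', hchain, fun S => ?_, ?_, ?_⟩
      · simp only [hmem, List.mem_cons (b := Q), or_and_right, exists_or, exists_eq_left, heq]
        refine ⟨.inr, fun h => h.elim (fun h => ⟨R, by simp, h⟩) id⟩
      · rw [hlast, List.getLast?_cons_cons]
      · rw [erasureCount_cons_cons]
        omega
    · refine ⟨R.filter (· ≤ T') :: L', List.isChain_cons_cons.2 ⟨hstep, hchain⟩,
        fun S => ?_, ?_, ?_⟩
      · rw [List.mem_cons, hmem, eq_comm]
        simp only [List.mem_cons (b := Q), or_and_right, exists_or, exists_eq_left]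
      · rw [List.getLast?_cons_cons, List.getLast?_cons_cons, hlast]
      · rw [erasureCount_cons_cons, erasureCount_cons_cons]
        split_ifs <;> first | omega | (exfalso; tauto)

/-- A play that starts below node `T'` and reaches a node `≥ T'` pebbles `T'` at some time. -/
theorem exists_mem_of_isChain {T T' : ℕ} (hT' : 1 ≤ T') (L : List (Finset ℕ)) (Q : Finset ℕ)
    (h : List.IsChain (PebbleStepE T) (Q :: L)) (hQ : ∀ i ∈ Q, i < T')
    (hreach : ∃ S ∈ Q :: L, ∃ i ∈ S, T' ≤ i) : ∃ S ∈ Q :: L, T' ∈ S := by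
  induction L generalizing Q with
  | nil =>
    obtain ⟨S, hS, i, hi, hle⟩ := hreach
    rw [List.mem_singleton] at hS
    subst hS
    exact absurd (hQ i hi) (by omega)
  | cons R L ih =>
    rw [List.isChain_cons_cons] at h
    by_cases hR : T' ∈ R
    · exact ⟨R, by simp, hR⟩
    have hRlt : ∀ i ∈ R, i < T' := by
      obtain ⟨i, h1, -, ⟨-, hpred, rfl⟩ | ⟨-, rfl⟩⟩ := h.1
      · intro k hk
        rcases Finset.mem_insert.1 hk with rfl | hk
        · have hne : k ≠ T' := by
            rintro rfl
            exact hR hk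
          rcases h1.eq_or_lt with h1 | h1
          · omega
          · have := hQ _ (hpred h1)
            omega
        · exact hQ k hk
      · exact fun k hk => hQ k (Finset.mem_of_mem_erase hk)
    obtain ⟨S, hS, hreachS⟩ := hreach
    rcases List.mem_cons.1 hS with rfl | hS
    · obtain ⟨i, hi, hle⟩ := hreachS
      exact absurd (hQ i hi) (by omega)
    · obtain ⟨S, hS, hmem⟩ := ih R h.2 hRlt ⟨S, hS, hreachS⟩
      exact ⟨S, List.mem_cons_of_mem _ hS, hmem⟩

/-- If a winning play for the pebble game of length `T` exists using at most `n` pebbles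
and at most `m` erasure-moves, then for every `T'` with `1 ≤ T' ≤ T` a winning play for
the pebble game of length `T'` exists using at most `n` pebbles and at most `m`
erasure-moves. -/
theorem winning_play_of_shorter_board (T T' n m : ℕ) (hT' : 1 ≤ T') (hTT : T' ≤ T)
    (h : ∃ P : List (Finset ℕ),
      IsPlayE T P ∧ UsesAtMost n P ∧ IsWinningE T P ∧ erasureCount P ≤ m) :
    ∃ P' : List (Finset ℕ),
      IsPlayE T' P' ∧ UsesAtMost n P' ∧ IsWinningE T' P' ∧ erasureCount P' ≤ m := by
  obtain ⟨P, ⟨hhead, hchain⟩, hcard, ⟨⟨S, hS, hTS⟩, hlast⟩, hcount⟩ := h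
  obtain ⟨L, rfl⟩ := List.head?_eq_some_iff.1 hhead
  obtain ⟨U, hU, hTU⟩ := exists_mem_of_isChain hT' L ∅ hchain (by simp) ⟨S, hS, T, hTS, hTT⟩
  obtain ⟨L', hchain', hmem', hlast', hcount'⟩ := exists_isChain_filter_le T' L ∅ hchain
  refine ⟨_, ⟨by simp, hchain'⟩, fun R hR => ?_, ⟨⟨_, (hmem' _).2 ⟨U, hU, rfl⟩, ?_⟩, ?_⟩,
    hcount'.trans hcount⟩
  · obtain ⟨V, hV, rfl⟩ := (hmem' R).1 hR
    exact (Finset.card_filter_le _ _).trans (hcard V hV)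
  · simp [hTU]
  · rw [hlast', hlast]
    simp
end

section
/- Time-bounded incompressibility hierarchy: there exists n_0 such that for every n ≥ n_0 there exist a binary string x of length n and a strictly increasing sequence of time bounds t_1 < t_2 < … < t_m, where m = ⌊(√n)/2⌋, such that the time-bounded Kolmogorov complexities strictly decrease: C^{t_1}(x) > C^{t_2}(x) > … > C^{t_m}(x). -/
/-- The length of a program: the bit-length of the natural-number encoding of a
partial recursive code. -/
def codeLength (c : Nat.Partrec.Code) : ℕ :=
  Nat.log 2 (Encodable.encode c) + 1

/-- The `t`-time-bounded Kolmogorov complexity of `x`: the minimal length of a code `c`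
whose step-bounded evaluation on input `0` with time bound `t` outputs `x`
(`⊤` if there is no such code). -/
noncomputable def timeBoundedC (t x : ℕ) : ℕ∞ :=
  sInf {N : ℕ∞ | ∃ c : Nat.Partrec.Code,
    Nat.Partrec.Code.evaln t c 0 = some x ∧ N = (codeLength c : ℕ∞)}

namespace TimeBounded

open Nat.Partrec (Code)
open Nat.Partrec.Code

/-- The natural-number encoding of a code. -/
def enc (c : Code) : ℕ := Encodable.encode c

theorem enc_zero : enc zero = 0 := rfl
theorem enc_succ : enc succ = 1 := rfl
theorem enc_right : enc right = 3 := rfl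

theorem enc_pair (f g : Code) : enc (pair f g) = 4 * Nat.pair (enc f) (enc g) + 4 := by
  simp only [enc, encodeCode_eq, encodeCode]; ring

theorem enc_comp (f g : Code) : enc (comp f g) = 4 * Nat.pair (enc f) (enc g) + 6 := by
  simp only [enc, encodeCode_eq, encodeCode]; ring

theorem enc_prec (f g : Code) : enc (prec f g) = 4 * Nat.pair (enc f) (enc g) + 5 := by
  simp only [enc, encodeCode_eq, encodeCode]; ring

theorem enc_rfind' (f : Code) : enc (rfind' f) = 4 * enc f + 7 := by
  simp only [enc, encodeCode_eq, encodeCode]; ring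

theorem enc_injective {c c' : Code} (h : enc c = enc c') : c = c' :=
  Encodable.encode_injective h

/-- The least possible encoding of a composite code one of whose parts has encoding `e`. -/
def psi (e : ℕ) : ℕ := 4 * e ^ 2 + 4

theorem psi_mono : Monotone psi := fun a b h => by unfold psi; gcongr

theorem lt_psi (e : ℕ) : e < psi e := by
  unfold psi; nlinarith [sq_nonneg ((e : ℤ) - 1), Nat.zero_le e]

theorem psi_left_le (a b : ℕ) : psi a ≤ 4 * Nat.pair a b + 4 := by
  have := Nat.max_sq_add_min_le_pair a b
  have h : a ^ 2 ≤ (max a b) ^ 2 := by gcongr; exact le_max_left _ _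
  unfold psi; omega

theorem psi_right_le (a b : ℕ) : psi b ≤ 4 * Nat.pair a b + 4 := by
  have := Nat.max_sq_add_min_le_pair a b
  have h : b ^ 2 ≤ (max a b) ^ 2 := by gcongr; exact le_max_right _ _
  unfold psi; omega

theorem evaln_zero_eq {t s y : ℕ} (h : evaln t zero s = some y) : y = 0 := by
  cases t with
  | zero => simp [evaln] at h
  | succ k => simp [evaln, Option.bind_eq_some_iff] at h; exact h.2.symm

theorem evaln_succ_eq {t s y : ℕ} (h : evaln t succ s = some y) : y = s + 1 := by
  cases t with
  | zero => simp [evaln] at h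
  | succ k => simp [evaln, Option.bind_eq_some_iff] at h; omega

theorem evaln_left_eq {t s y : ℕ} (h : evaln t left s = some y) : y = s.unpair.1 := by
  cases t with
  | zero => simp [evaln] at h
  | succ k => simp [evaln, Option.bind_eq_some_iff] at h; exact h.2.symm

theorem evaln_right_eq {t s y : ℕ} (h : evaln t right s = some y) : y = s.unpair.2 := by
  cases t with
  | zero => simp [evaln] at h
  | succ k => simp [evaln, Option.bind_eq_some_iff] at h; exact h.2.symm

theorem evaln_lt {t s y : ℕ} {c : Code} (h : evaln t c s = some y) : s < t := evaln_bound h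

theorem evaln_zero_some {t s : ℕ} (h : s < t) : evaln t zero s = some 0 := by
  obtain ⟨k, rfl⟩ : ∃ k, t = k + 1 := ⟨t - 1, by omega⟩
  simp [evaln, Nat.lt_succ_iff.1 h]

theorem evaln_succ_some {t s : ℕ} (h : s < t) : evaln t succ s = some (s + 1) := by
  obtain ⟨k, rfl⟩ : ∃ k, t = k + 1 := ⟨t - 1, by omega⟩
  simp [evaln, Nat.lt_succ_iff.1 h]

theorem evaln_left_some {t s : ℕ} (h : s < t) : evaln t left s = some s.unpair.1 := by
  obtain ⟨k, rfl⟩ : ∃ k, t = k + 1 := ⟨t - 1, by omega⟩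
  simp [evaln, Nat.lt_succ_iff.1 h]

theorem evaln_right_some {t s : ℕ} (h : s < t) : evaln t right s = some s.unpair.2 := by
  obtain ⟨k, rfl⟩ : ∃ k, t = k + 1 := ⟨t - 1, by omega⟩
  simp [evaln, Nat.lt_succ_iff.1 h]

theorem evaln_pair_iff {t s y : ℕ} {f g : Code} : evaln t (pair f g) s = some y ↔
    ∃ a b, y = Nat.pair a b ∧ evaln t f s = some a ∧ evaln t g s = some b := by
  cases t with
  | zero => simp [evaln]
  | succ k =>
    constructor
    · intro h
      have hs := Nat.lt_succ_iff.1 (evaln_lt h)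
      simp only [evaln, hs, guard_true, Seq.seq] at h
      simp [Option.bind_eq_some_iff] at h
      grind
    · rintro ⟨a, b, rfl, hf, hg⟩
      have hs := Nat.lt_succ_iff.1 (evaln_lt hf)
      simp [evaln, hs, hf, hg, Seq.seq]

theorem evaln_comp_iff {t s y : ℕ} {f g : Code} : evaln t (comp f g) s = some y ↔
    ∃ x, evaln t g s = some x ∧ evaln t f x = some y := by
  cases t with
  | zero => simp [evaln]
  | succ k =>
    constructor
    · intro h
      have hs := Nat.lt_succ_iff.1 (evaln_lt h)
      simpa [evaln, hs, Option.bind_eq_some_iff] using h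
    · rintro ⟨x, hg, hf⟩
      have hs := Nat.lt_succ_iff.1 (evaln_lt hg)
      simp [evaln, hs, hf, hg]

theorem evaln_pair_some {t s a b : ℕ} {f g : Code} (hf : evaln t f s = some a)
    (hg : evaln t g s = some b) : evaln t (pair f g) s = some (Nat.pair a b) :=
  evaln_pair_iff.2 ⟨a, b, rfl, hf, hg⟩

theorem evaln_comp_some {t s a b : ℕ} {f g : Code} (hg : evaln t g s = some a)
    (hf : evaln t f a = some b) : evaln t (comp f g) s = some b :=
  evaln_comp_iff.2 ⟨a, hg, hf⟩

theorem evaln_prec_cases {t s y : ℕ} {f g : Code} (h : evaln t (prec f g) s = some y) :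
    (s.unpair.2 = 0 ∧ evaln t f s.unpair.1 = some y) ∨
    ∃ n i, s.unpair.2 = n + 1 ∧
      evaln (t - 1) (prec f g) (Nat.pair s.unpair.1 n) = some i ∧
      evaln t g (Nat.pair s.unpair.1 (Nat.pair n i)) = some y := by
  cases t with
  | zero => simp [evaln] at h
  | succ k =>
    have hs := Nat.lt_succ_iff.1 (evaln_lt h)
    simp only [evaln, hs, guard_true] at h
    rcases hn : s.unpair.2 with _ | n
    · left
      simpa [Nat.unpaired, hn] using h
    · right
      simp [Nat.unpaired, hn, Option.bind_eq_some_iff] at h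
      obtain ⟨i, h1, h2⟩ := h
      exact ⟨n, i, rfl, h1, h2⟩

theorem evaln_rfind'_cases {t s y : ℕ} {f : Code} (h : evaln t (rfind' f) s = some y) :
    y = s.unpair.2 ∨ evaln (t - 1) (rfind' f) (Nat.pair s.unpair.1 (s.unpair.2 + 1)) = some y := by
  cases t with
  | zero => simp [evaln] at h
  | succ k =>
    have hs := Nat.lt_succ_iff.1 (evaln_lt h)
    simp [evaln, hs, Nat.unpaired, Option.bind_eq_some_iff] at h
    obtain ⟨x, _, h2⟩ := h
    split_ifs at h2 with hx
    · left; simpa using h2.symm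
    · right; simpa using h2

theorem evaln_rfind'_lt {t s y : ℕ} {f : Code} (h : evaln t (rfind' f) s = some y) : y < t := by
  induction t generalizing s with
  | zero => simp [evaln] at h
  | succ k ih =>
    rcases evaln_rfind'_cases h with h1 | h1
    · have := evaln_lt h
      have := Nat.unpair_right_le s
      omega
    · exact (ih h1).trans (Nat.lt_succ_self k)

/-- An output exceeding the time bound comes from a pairing. -/
theorem evaln_large {t s y : ℕ} {c : Code} (h : evaln t c s = some y) (hy : t < y) :
    (∃ f g a b, c = pair f g ∧ y = Nat.pair a b ∧
      evaln t f s = some a ∧ evaln t g s = some b) ∨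
    ∃ f s', evaln t f s' = some y ∧ psi (enc f) ≤ enc c := by
  have hs := evaln_lt h
  cases c with
  | zero => have := evaln_zero_eq h; omega
  | succ => have := evaln_succ_eq h; omega
  | left => have := evaln_left_eq h; have := Nat.unpair_left_le s; omega
  | right => have := evaln_right_eq h; have := Nat.unpair_right_le s; omega
  | pair f g =>
    obtain ⟨a, b, h1, h2, h3⟩ := evaln_pair_iff.1 h
    exact .inl ⟨f, g, a, b, rfl, h1, h2, h3⟩
  | comp f g =>
    obtain ⟨x, h1, h2⟩ := evaln_comp_iff.1 h
    refine .inr ⟨f, x, h2, ?_⟩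
    rw [enc_comp]; have := psi_left_le (enc f) (enc g); omega
  | prec f g =>
    right
    rcases evaln_prec_cases h with ⟨_, h1⟩ | ⟨n, i, _, _, h1⟩
    · refine ⟨f, _, h1, ?_⟩
      rw [enc_prec]; have := psi_left_le (enc f) (enc g); omega
    · refine ⟨g, _, h1, ?_⟩
      rw [enc_prec]; have := psi_right_le (enc f) (enc g); omega
  | rfind' f => have := evaln_rfind'_lt h; omega

/-- `gam h` bounds from below the codes producing a value with `h` nested pairings over a value
exceeding the time bound. -/
def gam (h : ℕ) : ℕ := psi^[h] 4

theorem gam_zero : gam 0 = 4 := rfl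
theorem gam_succ (h : ℕ) : gam (h + 1) = psi (gam h) := Function.iterate_succ_apply' _ _ _

/-- `Deep t h y`: some value at pairing depth `h` inside `y` exceeds `t`. -/
def Deep (t : ℕ) : ℕ → ℕ → Prop
  | 0, y => t < y
  | h + 1, y => ∃ a b, y = Nat.pair a b ∧ (Deep t h a ∨ Deep t h b)

theorem Deep.lt {t h y : ℕ} (hd : Deep t h y) : t < y := by
  induction h generalizing y with
  | zero => exact hd
  | succ h ih =>
    obtain ⟨a, b, rfl, h1 | h1⟩ := hd
    · exact (ih h1).trans_le (Nat.left_le_pair a b)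
    · exact (ih h1).trans_le (Nat.right_le_pair a b)

theorem Deep.gam_le {t h y : ℕ} (hd : Deep t h y) {c : Code} {s : ℕ}
    (hc : evaln t c s = some y) : gam h ≤ enc c := by
  induction he : enc c using Nat.strong_induction_on generalizing c s h y with
  | _ e ih =>
    subst he
    rcases evaln_large hc hd.lt with ⟨f, g, a, b, rfl, rfl, hf, hg⟩ | ⟨f, s', hf, hle⟩
    · rw [enc_pair]
      cases h with
      | zero => rw [gam_zero]; omega
      | succ h =>
        obtain ⟨a', b', hab, h1⟩ := hd
        obtain ⟨rfl, rfl⟩ := Nat.pair_eq_pair.1 hab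
        have pl := psi_left_le (enc f) (enc g)
        have pr := psi_right_le (enc f) (enc g)
        rw [gam_succ]
        rcases h1 with h1 | h1
        · have := ih (enc f) (by rw [enc_pair]; have := lt_psi (enc f); omega) h1 hf rfl
          exact (psi_mono this).trans pl
        · have := ih (enc g) (by rw [enc_pair]; have := lt_psi (enc g); omega) h1 hg rfl
          exact (psi_mono this).trans pr
    · have := lt_psi (enc f)
      exact (ih (enc f) (by omega) hd hf rfl).trans (by omega)

theorem Deep.pair_of_lt {t h y : ℕ} (hd : Deep t h y) {c : Code} {s : ℕ}
    (hc : evaln t c s = some y) (hlt : enc c < gam (h + 1)) :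
    ∃ f g a b, c = pair f g ∧ y = Nat.pair a b ∧ evaln t f s = some a ∧ evaln t g s = some b ∧
      enc f < gam h ∧ enc g < gam h := by
  rw [gam_succ] at hlt
  rcases evaln_large hc hd.lt with ⟨f, g, a, b, rfl, rfl, hf, hg⟩ | ⟨f, s', hf, hle⟩
  · rw [enc_pair] at hlt
    exact ⟨f, g, a, b, rfl, rfl, hf, hg,
      psi_mono.reflect_lt ((psi_left_le _ _).trans_lt hlt),
      psi_mono.reflect_lt ((psi_right_le _ _).trans_lt hlt)⟩
  · have := psi_mono (hd.gam_le hf)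
    omega

/-- `Above D y p`: the value `p` occurs at pairing depth `D` inside `y`. -/
def Above : ℕ → ℕ → ℕ → Prop
  | 0, y, p => y = p
  | D + 1, y, p => ∃ a b, y = Nat.pair a b ∧ (Above D a p ∨ Above D b p)

theorem Above.le {D y p : ℕ} (hd : Above D y p) : p ≤ y := by
  induction D generalizing y with
  | zero => exact hd.ge
  | succ h ih =>
    obtain ⟨a, b, rfl, h1 | h1⟩ := hd
    · exact (ih h1).trans (Nat.left_le_pair a b)
    · exact (ih h1).trans (Nat.right_le_pair a b)

theorem Above.psi_le {t D y p e : ℕ} (hd : Above D y p) (hp : t < p)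
    (hmin : ∀ c s, evaln t c s = some p → e ≤ enc c) {c : Code} {s : ℕ}
    (hc : evaln t c s = some y) : psi^[D] e ≤ enc c := by
  induction he : enc c using Nat.strong_induction_on generalizing c s D y with
  | _ e ih =>
    subst he
    rcases evaln_large hc (hp.trans_le hd.le) with
      ⟨f, g, a, b, rfl, rfl, hf, hg⟩ | ⟨f, s', hf, hle⟩
    · cases D with
      | zero => obtain rfl := hd; exact hmin _ _ hc
      | succ h =>
        rw [enc_pair]
        obtain ⟨a', b', hab, h1⟩ := hd
        obtain ⟨rfl, rfl⟩ := Nat.pair_eq_pair.1 hab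
        have pl := psi_left_le (enc f) (enc g)
        have pr := psi_right_le (enc f) (enc g)
        rw [Function.iterate_succ_apply']
        rcases h1 with h1 | h1
        · have := ih (enc f) (by rw [enc_pair]; have := lt_psi (enc f); omega) h1 hf rfl
          exact (psi_mono this).trans pl
        · have := ih (enc g) (by rw [enc_pair]; have := lt_psi (enc g); omega) h1 hg rfl
          exact (psi_mono this).trans pr
    · have := lt_psi (enc f)
      exact (ih (enc f) (by omega) hd hf rfl).trans (by omega)

theorem Above.psi_succ_le {t D y p e s : ℕ} (hd : Above D y p) (hp : t < p)
    (hmin : ∀ c s, evaln t c s = some p → e ≤ enc c)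
    (hmin' : ∀ c, evaln t c s = some p → psi e ≤ enc c) {c : Code}
    (hc : evaln t c s = some y) : psi^[D + 1] e ≤ enc c := by
  induction D generalizing c y with
  | zero => obtain rfl := hd; exact hmin' _ hc
  | succ h ih =>
    have hd' := hd
    obtain ⟨a', b', hab, h1⟩ := hd'
    rw [Function.iterate_succ_apply']
    rcases evaln_large hc (hp.trans_le hd.le) with
      ⟨f, g, a, b, rfl, rfl, hf, hg⟩ | ⟨f, s', hf, hle⟩
    · rw [enc_pair]
      obtain ⟨rfl, rfl⟩ := Nat.pair_eq_pair.1 hab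
      rcases h1 with h1 | h1
      · exact (psi_mono (ih h1 hf)).trans (psi_left_le _ _)
      · exact (psi_mono (ih h1 hg)).trans (psi_right_le _ _)
    · exact (psi_mono (hd.psi_le hp hmin hf)).trans hle

/-- Perfect binary trees of height `h` with leaves in `α`. -/
def Tr (α : Type) : ℕ → Type
  | 0 => α
  | h + 1 => Tr α h × Tr α h

instance Tr.fintype (α : Type) [Fintype α] : ∀ h, Fintype (Tr α h)
  | 0 => inferInstanceAs (Fintype α)
  | h + 1 => @instFintypeProd _ _ (Tr.fintype α h) (Tr.fintype α h)

theorem Tr.card (α : Type) [Fintype α] (h : ℕ) :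
    Fintype.card (Tr α h) = Fintype.card α ^ 2 ^ h := by
  induction h with
  | zero => rw [pow_zero, pow_one]; rfl
  | succ h ih =>
    have : Fintype.card (Tr α (h + 1)) = Fintype.card (Tr α h) * Fintype.card (Tr α h) :=
      Fintype.card_prod _ _
    rw [this, ih, pow_succ, ← pow_add, mul_two]

variable {α : Type}

/-- The value of a tree: its leaves combined by the pairing function. -/
def Tr.val (f : α → ℕ) : ∀ {h : ℕ}, Tr α h → ℕ
  | 0, x => f x
  | _ + 1, x => Nat.pair (Tr.val f x.1) (Tr.val f x.2)

/-- The code combining codes of the leaves by pairing. -/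
def Tr.code (C : α → Code) : ∀ {h : ℕ}, Tr α h → Code
  | 0, x => C x
  | _ + 1, x => pair (Tr.code C x.1) (Tr.code C x.2)

/-- The encoding of a tree code, computed from the encodings at its leaves. -/
def Tr.cost (k : α → ℕ) : ∀ {h : ℕ}, Tr α h → ℕ
  | 0, x => k x
  | _ + 1, x => 4 * Nat.pair (Tr.cost k x.1) (Tr.cost k x.2) + 4

theorem Tr.val_injective {f : α → ℕ} (hf : f.Injective) :
    ∀ {h : ℕ}, Function.Injective (Tr.val f : Tr α h → ℕ)
  | 0 => hf
  | _ + 1 => fun x y hxy => by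
    obtain ⟨h1, h2⟩ := Nat.pair_eq_pair.1 (show Nat.pair _ _ = Nat.pair _ _ from hxy)
    exact Prod.ext (Tr.val_injective hf h1) (Tr.val_injective hf h2)

theorem Tr.cost_injective {k : α → ℕ} (hk : k.Injective) :
    ∀ {h : ℕ}, Function.Injective (Tr.cost k : Tr α h → ℕ)
  | 0 => hk
  | _ + 1 => fun x y hxy => by
    have hxy : 4 * Nat.pair (Tr.cost k x.1) (Tr.cost k x.2) + 4 =
      4 * Nat.pair (Tr.cost k y.1) (Tr.cost k y.2) + 4 := hxy
    obtain ⟨h1, h2⟩ := Nat.pair_eq_pair.1 (show Nat.pair (Tr.cost k x.1) (Tr.cost k x.2) =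
      Nat.pair (Tr.cost k y.1) (Tr.cost k y.2) by omega)
    exact Prod.ext (Tr.cost_injective hk h1) (Tr.cost_injective hk h2)

theorem Tr.evaln_code {C : α → Code} {f : α → ℕ} {t s : ℕ}
    (hC : ∀ x, evaln t (C x) s = some (f x)) :
    ∀ {h : ℕ} (T : Tr α h), evaln t (T.code C) s = some (T.val f)
  | 0, x => hC x
  | _ + 1, x => evaln_pair_some (Tr.evaln_code hC x.1) (Tr.evaln_code hC x.2)

theorem Tr.enc_code {C : α → Code} :
    ∀ {h : ℕ} (T : Tr α h), enc (T.code C) = T.cost fun x => enc (C x)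
  | 0, x => rfl
  | _ + 1, x => by
    change enc (pair _ _) = _
    rw [enc_pair, Tr.enc_code x.1, Tr.enc_code x.2]; rfl

theorem pair_le_max (a b : ℕ) : Nat.pair a b ≤ max a b ^ 2 + 2 * max a b := by
  have h := Nat.pair_lt_max_add_one_sq a b
  nlinarith

theorem four_mul_pair_le {a b m : ℕ} (ha : 4 * a + 5 ≤ m) (hb : 4 * b + 5 ≤ m) :
    4 * (4 * Nat.pair a b + 4) + 5 ≤ m ^ 2 := by
  have h := pair_le_max a b
  have hm : 4 * max a b + 5 ≤ m := by rcases max_choice a b with h | h <;> omega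
  have := Nat.pow_le_pow_left hm 2
  generalize max a b = M at *
  nlinarith

theorem four_mul_pair_le' {a b m : ℕ} (hm6 : 6 ≤ m) (ha : 4 * a + 5 ≤ m) (hb : 4 * b + 5 ≤ m) :
    4 * (4 * Nat.pair a b + 6) + 5 ≤ m ^ 2 := by
  have h := pair_le_max a b
  have hm : 4 * max a b + 5 ≤ m := by rcases max_choice a b with h | h <;> omega
  rcases Nat.eq_zero_or_pos (max a b) with h0 | h0
  · rw [h0] at h; nlinarith
  · have := Nat.pow_le_pow_left hm 2
    nlinarith

theorem le_four_mul_pair {a b m : ℕ} (h : m ≤ 4 * a ∨ m ≤ 4 * b) :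
    m ^ 2 ≤ 4 * (4 * Nat.pair a b + 4) := by
  have h1 := psi_left_le a b
  have h2 := psi_right_le a b
  unfold psi at h1 h2
  rcases h with h | h <;> nlinarith

theorem Tr.cost_le {k : α → ℕ} {m : ℕ} (hk : ∀ x, 4 * k x + 5 ≤ m) :
    ∀ {h : ℕ} (T : Tr α h), 4 * T.cost k + 5 ≤ m ^ 2 ^ h
  | 0, x => by rw [pow_zero, pow_one]; exact hk x
  | h + 1, x => by
    rw [pow_succ 2 h, pow_mul]
    exact four_mul_pair_le (Tr.cost_le hk x.1) (Tr.cost_le hk x.2)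

theorem Tr.le_cost {k : α → ℕ} {m : ℕ} (hk : ∀ x, m ≤ 4 * k x) :
    ∀ {h : ℕ} (T : Tr α h), m ^ 2 ^ h ≤ 4 * T.cost k
  | 0, x => by rw [pow_zero, pow_one]; exact hk x
  | h + 1, x => by
    rw [pow_succ 2 h, pow_mul]
    exact le_four_mul_pair (.inl (Tr.le_cost hk x.1))

theorem Tr.cost_succ (k : α → ℕ) {h : ℕ} (x : Tr α (h + 1)) :
    x.cost k = 4 * Nat.pair (Tr.cost k x.1) (Tr.cost k x.2) + 4 := rfl

theorem Tr.val_succ (f : α → ℕ) {h : ℕ} (x : Tr α (h + 1)) :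
    x.val f = Nat.pair (Tr.val f x.1) (Tr.val f x.2) := rfl

theorem pow_le_four_mul_psi_iterate {m e : ℕ} (h : m ≤ 4 * e) (D : ℕ) :
    m ^ 2 ^ D ≤ 4 * psi^[D] e := by
  induction D with
  | zero => simpa using h
  | succ D ih =>
    rw [Function.iterate_succ_apply', pow_succ 2 D, pow_mul, psi]
    have := Nat.pow_le_pow_left ih 2
    nlinarith

theorem pow_le_four_mul_gam (h : ℕ) : 272 ^ 2 ^ h ≤ 4 * gam (h + 1) := by
  have := pow_le_four_mul_psi_iterate (m := 272) (e := 68) (by norm_num) h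
  rwa [gam, Function.iterate_succ_apply]

/-- The small seed component. -/
def uu (d a : ℕ) : ℕ := (d - 1) ^ 2 + a
/-- The large seed component. -/
def ww (d : ℕ) : ℕ := d ^ 2 + 2
/-- The seed available from the start. -/
def sA (d a : ℕ) : ℕ := Nat.pair (uu d a) (ww d)
/-- The seed that becomes available later. -/
def sB (d a : ℕ) : ℕ := Nat.pair (ww d) (uu d a)
/-- A value which never becomes available as a seed. -/
def sC (d : ℕ) : ℕ := Nat.pair (ww d) (ww d)

/-- Admissibility of the parameters. -/
structure Cand (d a : ℕ) : Prop where
  three_le : 3 ≤ a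
  add_le : a + 3 ≤ d

/-- The values at the leaves of the blocks. -/
def letter (d a : ℕ) : Fin 17 → ℕ :=
  ![0, 1, 2, a, d, uu d a, uu d a + 1, ww d, ww d + 1, Nat.pair 0 (uu d a), Nat.pair (uu d a) 0,
    Nat.pair (uu d a) (uu d a), Nat.pair 0 (ww d), Nat.pair (uu d a) (ww d),
    Nat.pair (ww d) 0, Nat.pair (ww d) (uu d a), Nat.pair (ww d) (ww d)]

/-- The codes of the leaves on the first seed. -/
def codeA : Fin 17 → Code :=
  ![zero, comp succ zero, comp left right, comp left left, comp right right, left, comp succ left,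
    right, comp succ right, pair zero left, pair left zero, pair left left, pair zero right,
    pair left right, pair right zero, pair right left, pair right right]

/-- The codes of the leaves on the second seed. -/
def codeB : Fin 17 → Code :=
  ![zero, comp succ zero, comp left left, comp left right, comp right left, right, comp succ right,
    left, comp succ left, pair zero right, pair right zero, pair right right, pair zero left,
    pair right left, pair left zero, pair left right, pair left left]

theorem enc_codeA_le (x : Fin 17) : 4 * enc (codeA x) + 5 ≤ 269 := by
  have h : ∀ x : Fin 17, Encodable.encode (codeA x) ≤ 66 := by
    rw [encodeCode_eq]; decide
  have := h x
  unfold enc; omega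

theorem enc_codeB_le (x : Fin 17) : 4 * enc (codeB x) + 5 ≤ 261 := by
  have h : ∀ x : Fin 17, Encodable.encode (codeB x) ≤ 64 := by
    rw [encodeCode_eq]; decide
  have := h x
  unfold enc; omega

theorem sC_eq {d : ℕ} : sC d = ww d ^ 2 + 2 * ww d := by
  rw [sC, Nat.pair, if_neg (by omega)]; ring

namespace Cand

variable {d a : ℕ}

theorem uu_lt (hc : Cand d a) : uu d a + 1 < ww d := by
  obtain ⟨h1, h2⟩ := hc
  obtain ⟨e, rfl⟩ : ∃ e, d = e + 1 := ⟨d - 1, by omega⟩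
  simp only [uu, ww, Nat.add_sub_cancel]; nlinarith

theorem lt_uu (hc : Cand d a) : d < uu d a := by
  obtain ⟨h1, h2⟩ := hc
  obtain ⟨e, rfl⟩ : ∃ e, d = e + 1 := ⟨d - 1, by omega⟩
  simp only [uu, Nat.add_sub_cancel]; nlinarith

theorem unpair_uu (hc : Cand d a) : (uu d a).unpair = (a, d - 1) := by
  obtain ⟨h1, h2⟩ := hc
  rw [← Nat.unpair_pair a (d - 1), Nat.pair, if_pos (by omega), uu]; ring_nf

theorem unpair_ww (hc : Cand d a) : (ww d).unpair = (2, d) := by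
  obtain ⟨h1, h2⟩ := hc
  rw [← Nat.unpair_pair 2 d, Nat.pair, if_pos (by omega), ww]; ring_nf

theorem sA_eq (hc : Cand d a) : sA d a = ww d ^ 2 + uu d a := by
  have := hc.uu_lt
  rw [sA, Nat.pair, if_pos (by omega)]; ring

theorem sB_eq (hc : Cand d a) : sB d a = ww d ^ 2 + ww d + uu d a := by
  have := hc.uu_lt
  rw [sB, Nat.pair, if_neg (by omega)]; ring

theorem sB_lt (hc : Cand d a) : sB d a + 1 < sC d := by
  have := hc.uu_lt
  rw [hc.sB_eq, sC_eq]; omega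

theorem sA_lt (hc : Cand d a) : sA d a < sB d a := by
  have := hc.lt_uu
  have := hc.uu_lt
  rw [hc.sB_eq, hc.sA_eq]; omega

theorem strictMono_letter (hc : Cand d a) : StrictMono (letter d a) := by
  have h1 := hc.uu_lt
  have h2 := hc.lt_uu
  obtain ⟨h3, h4⟩ := hc
  rw [Fin.strictMono_iff_lt_succ]
  have p0u : Nat.pair 0 (uu d a) = uu d a ^ 2 := by rw [Nat.pair, if_pos (by omega)]; ring
  have pu0 : Nat.pair (uu d a) 0 = uu d a ^ 2 + uu d a := by
    rw [Nat.pair, if_neg (by omega)]; ring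
  have puu : Nat.pair (uu d a) (uu d a) = uu d a ^ 2 + 2 * uu d a := by
    rw [Nat.pair, if_neg (by omega)]; ring
  have p0w : Nat.pair 0 (ww d) = ww d ^ 2 := by rw [Nat.pair, if_pos (by omega)]; ring
  have puw : Nat.pair (uu d a) (ww d) = ww d ^ 2 + uu d a := by
    rw [Nat.pair, if_pos (by omega)]; ring
  have pw0 : Nat.pair (ww d) 0 = ww d ^ 2 + ww d := by
    rw [Nat.pair, if_neg (by omega)]; ring
  have pwu : Nat.pair (ww d) (uu d a) = ww d ^ 2 + ww d + uu d a := by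
    rw [Nat.pair, if_neg (by omega)]; ring
  have pww : Nat.pair (ww d) (ww d) = ww d ^ 2 + 2 * ww d := by
    rw [Nat.pair, if_neg (by omega)]; ring
  have e1 : ww d + 1 < uu d a ^ 2 := by
    obtain ⟨e, rfl⟩ : ∃ e, d = e + 1 := ⟨d - 1, by omega⟩
    have : e ^ 2 + 3 ≤ uu (e + 1) a := by simp only [uu, Nat.add_sub_cancel]; omega
    have h5 : 5 ≤ e := by omega
    simp only [ww]; nlinarith
  have e2 : uu d a ^ 2 + 2 * uu d a < ww d ^ 2 := by nlinarith
  simp only [letter, p0u, pu0, puu, p0w, puw, pw0, pwu, pww]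
  generalize uu d a = u at *
  generalize ww d = w at *
  clear p0u pu0 puu p0w puw pw0 pwu pww
  intro i
  fin_cases i <;> simp <;> omega

theorem evaln_codeA (hc : Cand d a) {t : ℕ} (ht : sA d a < t) (x : Fin 17) :
    evaln t (codeA x) (sA d a) = some (letter d a x) := by
  have h1 := hc.uu_lt
  have h2 := hc.lt_uu
  have e := hc.sA_eq
  have hu : uu d a < t := by nlinarith
  have hw : ww d < t := by nlinarith
  have h0 : 0 < t := by omega
  have L : evaln t left (sA d a) = some (uu d a) := by
    simpa [sA] using evaln_left_some ht
  have R : evaln t right (sA d a) = some (ww d) := by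
    simpa [sA] using evaln_right_some ht
  have Z := evaln_zero_some ht
  have LL : evaln t left (uu d a) = some a := by
    simpa [hc.unpair_uu] using evaln_left_some hu
  have LR : evaln t left (ww d) = some 2 := by
    simpa [hc.unpair_ww] using evaln_left_some hw
  have RR : evaln t right (ww d) = some d := by
    simpa [hc.unpair_ww] using evaln_right_some hw
  fin_cases x
  exacts [Z, evaln_comp_some Z (evaln_succ_some h0), evaln_comp_some R LR, evaln_comp_some L LL,
    evaln_comp_some R RR, L, evaln_comp_some L (evaln_succ_some hu), R,
    evaln_comp_some R (evaln_succ_some hw), evaln_pair_some Z L, evaln_pair_some L Z,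
    evaln_pair_some L L, evaln_pair_some Z R, evaln_pair_some L R, evaln_pair_some R Z,
    evaln_pair_some R L, evaln_pair_some R R]

theorem evaln_codeB (hc : Cand d a) {t : ℕ} (ht : sB d a < t) (x : Fin 17) :
    evaln t (codeB x) (sB d a) = some (letter d a x) := by
  have h1 := hc.uu_lt
  have h2 := hc.lt_uu
  have e := hc.sB_eq
  have hu : uu d a < t := by nlinarith
  have hw : ww d < t := by nlinarith
  have h0 : 0 < t := by omega
  have R : evaln t right (sB d a) = some (uu d a) := by
    simpa [sB] using evaln_right_some ht
  have L : evaln t left (sB d a) = some (ww d) := by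
    simpa [sB] using evaln_left_some ht
  have Z := evaln_zero_some ht
  have LL : evaln t left (uu d a) = some a := by
    simpa [hc.unpair_uu] using evaln_left_some hu
  have LR : evaln t left (ww d) = some 2 := by
    simpa [hc.unpair_ww] using evaln_left_some hw
  have RR : evaln t right (ww d) = some d := by
    simpa [hc.unpair_ww] using evaln_right_some hw
  fin_cases x
  exacts [Z, evaln_comp_some Z (evaln_succ_some h0), evaln_comp_some L LR, evaln_comp_some R LL,
    evaln_comp_some L RR, R, evaln_comp_some R (evaln_succ_some hu), L,
    evaln_comp_some L (evaln_succ_some hw), evaln_pair_some Z R, evaln_pair_some R Z,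
    evaln_pair_some R R, evaln_pair_some Z L, evaln_pair_some R L, evaln_pair_some L Z,
    evaln_pair_some L R, evaln_pair_some L L]

end Cand

theorem pair_mono {a b a' b' : ℕ} (ha : a ≤ a') (hb : b ≤ b') : Nat.pair a b ≤ Nat.pair a' b' :=
  ((StrictMono.monotone fun _ _ h => Nat.pair_lt_pair_left b h) ha).trans
    ((StrictMono.monotone fun _ _ h => Nat.pair_lt_pair_right a' h) hb)

theorem sq_left_le_pair (a b : ℕ) : a ^ 2 ≤ Nat.pair a b := by
  have := psi_left_le a b
  unfold psi at this; omega

theorem sq_right_le_pair (a b : ℕ) : b ^ 2 ≤ Nat.pair a b := by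
  have := psi_right_le a b
  unfold psi at this; omega

/-- A code with encoding below `4` is one of the four basic functions. -/
theorem evaln_basic {t s y : ℕ} {c : Code} (hc : enc c < 4) (h : evaln t c s = some y) :
    (c = zero ∧ y = 0) ∨ (c = succ ∧ y = s + 1) ∨ (c = left ∧ y = s.unpair.1) ∨
      (c = right ∧ y = s.unpair.2) := by
  cases c with
  | zero => exact .inl ⟨rfl, evaln_zero_eq h⟩
  | succ => exact .inr (.inl ⟨rfl, evaln_succ_eq h⟩)
  | left => exact .inr (.inr (.inl ⟨rfl, evaln_left_eq h⟩))
  | right => exact .inr (.inr (.inr ⟨rfl, evaln_right_eq h⟩))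
  | pair f g => rw [enc_pair] at hc; omega
  | comp f g => rw [enc_comp] at hc; omega
  | prec f g => rw [enc_prec] at hc; omega
  | rfind' f => rw [enc_rfind'] at hc; omega

namespace Cand

variable {d a : ℕ}

/-- The value `d` is expensive on the first seed. -/
theorem le_enc_of_evaln_sA (hc : Cand d a) {t : ℕ} (ht : t ≤ sC d) {c : Code}
    (h : evaln t c (sA d a) = some d) : 66 ≤ enc c := by
  by_contra! hlt
  have h1 := hc.uu_lt
  have h2 := hc.lt_uu
  have hsA := hc.sA_eq
  have hst := evaln_lt h
  have hw1 : ww d ≤ ww d ^ 2 := by nlinarith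
  have hu : (sA d a).unpair = (uu d a, ww d) := Nat.unpair_pair _ _
  have h3 := hc.three_le
  have h4 := hc.add_le
  have basic : ∀ {f : Code} {y : ℕ}, enc f < 4 → evaln t f (sA d a) = some y →
      y = 0 ∨ y = sA d a + 1 ∨ y = uu d a ∨ y = ww d := by
    intro f y hf hy
    rcases evaln_basic hf hy with h | h | h | h <;> (try simp only [hu] at h) <;> tauto
  have small' : ∀ {x y : ℕ}, 4 * Nat.pair x y + 4 < 66 → x < 4 ∧ y < 4 := by
    intro x y hxy
    have hx := psi_left_le x y
    have hy := psi_right_le x y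
    constructor <;>
    · by_contra! h
      have := psi_mono h
      simp only [psi] at this hx hy; omega
  cases c with
  | zero => have := evaln_zero_eq h; omega
  | succ => have := evaln_succ_eq h; omega
  | left => have := evaln_left_eq h; rw [hu] at this; dsimp only at this; omega
  | right => have := evaln_right_eq h; rw [hu] at this; dsimp only at this; omega
  | pair f g =>
    rw [enc_pair] at hlt
    obtain ⟨hf, hg⟩ := small' hlt
    obtain ⟨x, y, hd, hx, hy⟩ := evaln_pair_iff.1 h
    have hx := basic hf hx
    have hy := basic hg hy
    have l1 := Nat.left_le_pair x y
    have l2 := Nat.right_le_pair x y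
    have : x = 0 ∧ y = 0 := by omega
    rw [this.1, this.2] at hd
    simp [Nat.pair] at hd; omega
  | comp f g =>
    rw [enc_comp] at hlt
    obtain ⟨hf, hg⟩ := small' (show 4 * Nat.pair (enc f) (enc g) + 4 < 66 by omega)
    obtain ⟨x, hx, hy⟩ := evaln_comp_iff.1 h
    have h5 : (sA d a + 1).unpair = (uu d a + 1, ww d) := by
      rw [← Nat.unpair_pair (uu d a + 1) (ww d), Nat.pair, if_pos h1, hsA]; congr 1; ring
    have bx := basic hg hx
    rcases evaln_basic hf hy with h6 | h6 | h6 | h6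
    · omega
    · omega
    · obtain ⟨rfl, h6⟩ := h6
      rcases bx with rfl | rfl | rfl | rfl
      · simp at h6; omega
      · rw [h5] at h6; dsimp only at h6; omega
      · rw [hc.unpair_uu] at h6; dsimp only at h6; omega
      · rw [hc.unpair_ww] at h6; dsimp only at h6; omega
    · obtain ⟨rfl, h6⟩ := h6
      rcases evaln_basic hg hx with h7 | h7 | h7 | h7
      · obtain ⟨rfl, rfl⟩ := h7
        simp at h6; omega
      · obtain ⟨rfl, rfl⟩ := h7
        rw [h5] at h6; dsimp only at h6; omega
      · obtain ⟨rfl, rfl⟩ := h7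
        rw [hu, hc.unpair_uu] at h6; dsimp only at h6; omega
      · obtain ⟨rfl, rfl⟩ := h7
        rw [enc_right] at hlt
        have : Nat.pair 3 3 = 15 := rfl
        omega
  | prec f g =>
    rcases evaln_prec_cases h with ⟨h0, _⟩ | ⟨n, i, hn, _, hg⟩
    · rw [hu] at h0; dsimp only at h0; omega
    · rw [hu] at hn hg
      dsimp only at hn hg
      have b1 := evaln_lt hg
      have b4 := sq_left_le_pair n i
      have b5 := sq_right_le_pair (uu d a) (Nat.pair n i)
      have b6 := Nat.pow_le_pow_left b4 2
      rw [sC_eq] at ht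
      have : 4 ≤ n := by omega
      have b7 : 16 * n ^ 2 ≤ (n ^ 2) ^ 2 := by
        have := Nat.pow_le_pow_left this 2
        nlinarith
      rw [hn] at ht
      nlinarith
  | rfind' f =>
    rcases evaln_rfind'_cases h with h0 | h0
    · rw [hu] at h0; dsimp only at h0; omega
    · have b1 := evaln_lt h0
      rw [hu] at b1
      dsimp only at b1
      have b5 := sq_right_le_pair (uu d a) (ww d + 1)
      rw [sC_eq] at ht
      have : (ww d + 1) ^ 2 = ww d ^ 2 + 2 * ww d + 1 := by ring
      omega

/-- Before the second seed is available, short codes produce it only from the first one. -/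
theorem eq_sA_of_evaln_sB (hc : Cand d a) {t : ℕ} (ht : t < sB d a) {c : Code}
    (hlt : enc c < gam 1) {s : ℕ} (h : evaln t c s = some (sB d a)) : s = sA d a := by
  have hD : Deep t 0 (sB d a) := ht
  obtain ⟨f, g, x, y, rfl, hxy, hf, hg, hf4, hg4⟩ := hD.pair_of_lt h hlt
  obtain ⟨rfl, rfl⟩ := Nat.pair_eq_pair.1 hxy
  have h1 := hc.uu_lt
  have h2 := hc.lt_uu
  have hst := evaln_lt h
  have h3 := hc.three_le
  have h4 := hc.add_le
  have hs := Nat.pair_unpair s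
  rcases evaln_basic hf4 hf with h5 | ⟨_, h5⟩ | ⟨_, h5⟩ | ⟨_, h5⟩
  · omega
  · obtain rfl : s = d ^ 2 + 1 := by unfold ww at h5; omega
    have h6 : (d ^ 2 + 1).unpair = (1, d) := by
      rw [← Nat.unpair_pair 1 d, Nat.pair, if_pos (by omega)]; ring_nf
    rcases evaln_basic hg4 hg with h5 | ⟨_, h5⟩ | ⟨_, h5⟩ | ⟨_, h5⟩
    · omega
    · omega
    · rw [h6] at h5; dsimp only at h5; omega
    · rw [h6] at h5; dsimp only at h5; omega
  · have h7 := Nat.unpair_left_le s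
    rcases evaln_basic hg4 hg with h6 | ⟨_, h6⟩ | ⟨_, h6⟩ | ⟨_, h6⟩
    · omega
    · omega
    · omega
    · rw [← h5, ← h6] at hs
      unfold sB at ht; omega
  · have h7 := Nat.unpair_right_le s
    rcases evaln_basic hg4 hg with h6 | ⟨_, h6⟩ | ⟨_, h6⟩ | ⟨_, h6⟩
    · omega
    · omega
    · rw [← h5, ← h6] at hs
      exact hs.symm
    · omega

end Cand

/-- The blocks: letter trees with a prescribed leftmost part. -/
def Blk : ℕ → Type
  | 0 => Unit
  | i + 1 => Blk i × Tr (Fin 17) (i + 2)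

instance Blk.fintype : ∀ i, Fintype (Blk i)
  | 0 => inferInstanceAs (Fintype Unit)
  | i + 1 => @instFintypeProd _ _ (Blk.fintype i) (Tr.fintype (Fin 17) (i + 2))

theorem Blk.card (i : ℕ) : Fintype.card (Blk i) = 17 ^ (2 ^ (i + 2) - 4) := by
  induction i with
  | zero => rfl
  | succ i ih =>
    have : Fintype.card (Blk (i + 1)) = Fintype.card (Blk i) * Fintype.card (Tr (Fin 17) (i + 2)) :=
      Fintype.card_prod _ _
    rw [this, ih, Tr.card, Fintype.card_fin, ← pow_add]
    congr 1
    have : 2 ^ (i + 1 + 2) = 2 * 2 ^ (i + 2) := by ring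
    have : 2 ^ (i + 2) = 4 * 2 ^ i := by ring
    have := Nat.one_le_two_pow (n := i)
    omega

/-- The letter tree of a block. -/
def Blk.toTr : ∀ {i : ℕ}, Blk i → Tr (Fin 17) (i + 2)
  | 0, _ => (((4, 16) : Fin 17 × Fin 17), ((15, 16) : Fin 17 × Fin 17))
  | _ + 1, x => (Blk.toTr x.1, x.2)

theorem Blk.toTr_injective : ∀ {i : ℕ}, Function.Injective (Blk.toTr : Blk i → _)
  | 0 => fun _ _ _ => rfl
  | _ + 1 => fun x y hxy => by
    obtain ⟨h1, h2⟩ := Prod.ext_iff.1 hxy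
    exact Prod.ext (Blk.toTr_injective h1) h2

/-- The value of a block. -/
def Blk.val (d a : ℕ) {i : ℕ} (B : Blk i) : ℕ := B.toTr.val (letter d a)

theorem Blk.val_zero (d a : ℕ) (B : Blk 0) :
    B.val d a = Nat.pair (Nat.pair d (sC d)) (Nat.pair (sB d a) (sC d)) := rfl

theorem Blk.val_succ (d a : ℕ) {i : ℕ} (B : Blk (i + 1)) :
    B.val d a = Nat.pair (Blk.val d a B.1) (Tr.val (letter d a) B.2) := rfl

namespace Cand

variable {d a : ℕ}

theorem blk_val_injective (hc : Cand d a) {i : ℕ} : Function.Injective (Blk.val d a : Blk i → ℕ) :=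
  (Tr.val_injective hc.strictMono_letter.injective).comp Blk.toTr_injective

theorem deep_val {t : ℕ} (ht : t < sB d a) {i : ℕ} (B : Blk i) : Deep t (i + 2) (B.val d a) := by
  induction i with
  | zero => exact ⟨_, _, rfl, .inr ⟨_, _, rfl, .inl ht⟩⟩
  | succ i ih => exact ⟨_, _, rfl, .inl (ih B.1)⟩

/-- Before the second seed is available, short codes produce a block only from the first one,
and they are expensive. -/
theorem blk_lower (hc : Cand d a) {t : ℕ} (ht : t < sB d a) {i : ℕ} (B : Blk i) {c : Code} {s : ℕ}
    (hlt : enc c < gam (i + 3)) (h : evaln t c s = some (B.val d a)) :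
    s = sA d a ∧ 264 ^ 2 ^ (i + 2) ≤ 4 * enc c := by
  induction i generalizing c with
  | zero =>
    obtain ⟨f, g, x, y, rfl, hxy, hf, hg, hf4, hg4⟩ := (deep_val ht B).pair_of_lt h hlt
    rw [Blk.val_zero] at hxy
    obtain ⟨rfl, rfl⟩ := Nat.pair_eq_pair.1 hxy
    have hsC : t < sC d := by have := hc.sB_lt; omega
    have D1 : Deep t 1 (Nat.pair (sB d a) (sC d)) := ⟨_, _, rfl, .inl ht⟩
    have D2 : Deep t 1 (Nat.pair d (sC d)) := ⟨_, _, rfl, .inr hsC⟩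
    obtain ⟨f', g', x, y, rfl, hxy, hf', hg', hf4', hg4'⟩ := D1.pair_of_lt hg hg4
    obtain ⟨rfl, rfl⟩ := Nat.pair_eq_pair.1 hxy
    obtain rfl := hc.eq_sA_of_evaln_sB ht hf4' hf'
    refine ⟨rfl, ?_⟩
    obtain ⟨f, g₂, x, y, rfl, hxy, hf, hg₂, -, -⟩ := D2.pair_of_lt hf hf4
    obtain ⟨rfl, rfl⟩ := Nat.pair_eq_pair.1 hxy
    have := hc.le_enc_of_evaln_sA hsC.le hf
    rw [enc_pair, enc_pair]
    have h1 := le_four_mul_pair (m := 264) (a := enc f) (b := enc g₂) (by omega)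
    exact (show 264 ^ 2 ^ (0 + 2) = (264 ^ 2) ^ 2 by norm_num).le.trans
      (le_four_mul_pair (.inl h1))
  | succ i ih =>
    obtain ⟨f, g, x, y, rfl, hxy, hf, hg, hf4, hg4⟩ := (deep_val ht B).pair_of_lt h hlt
    rw [Blk.val_succ] at hxy
    obtain ⟨rfl, rfl⟩ := Nat.pair_eq_pair.1 hxy
    obtain ⟨h1, h2⟩ := ih B.1 hf4 hf
    refine ⟨h1, ?_⟩
    rw [enc_pair, pow_succ 2 (i + 2), pow_mul]
    exact le_four_mul_pair (.inl h2)

end Cand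

/-- The least encoding of a code producing the block `B` from the first seed. -/
noncomputable def kap (d a t : ℕ) {i : ℕ} (B : Blk i) : ℕ :=
  sInf {e | ∃ c, enc c = e ∧ evaln t c (sA d a) = some (B.val d a)}

theorem kap_le {d a t : ℕ} {i : ℕ} {B : Blk i} {c : Code}
    (h : evaln t c (sA d a) = some (B.val d a)) : kap d a t B ≤ enc c :=
  Nat.sInf_le ⟨c, rfl, h⟩

namespace Cand

variable {d a : ℕ}

theorem exists_kap (hc : Cand d a) {t : ℕ} (ht : sA d a < t) {i : ℕ} (B : Blk i) :
    ∃ c, enc c = kap d a t B ∧ evaln t c (sA d a) = some (B.val d a) :=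
  Nat.sInf_mem (s := {e | ∃ c, enc c = e ∧ evaln t c (sA d a) = some (B.val d a)})
    ⟨_, _, rfl, Tr.evaln_code (hc.evaln_codeA ht) B.toTr⟩

theorem kap_injective (hc : Cand d a) {t : ℕ} (ht : sA d a < t) {i : ℕ} :
    Function.Injective (kap d a t : Blk i → ℕ) := by
  intro B B' h
  obtain ⟨c, h1, h2⟩ := hc.exists_kap ht B
  obtain ⟨c', h1', h2'⟩ := hc.exists_kap ht B'
  obtain rfl : c = c' := enc_injective (by rw [h1, h1', h])
  rw [h2, Option.some_inj] at h2'
  exact hc.blk_val_injective h2'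

theorem four_mul_kap_le (hc : Cand d a) {t : ℕ} (ht : sA d a < t) {i : ℕ} (B : Blk i) :
    4 * kap d a t B + 5 ≤ 269 ^ 2 ^ (i + 2) := by
  have h1 := kap_le (Tr.evaln_code (hc.evaln_codeA ht) B.toTr)
  rw [Tr.enc_code] at h1
  have h2 := Tr.cost_le enc_codeA_le B.toTr
  omega

theorem kap_anti (hc : Cand d a) {t t' : ℕ} (ht : sA d a < t) (h : t ≤ t') {i : ℕ} (B : Blk i) :
    kap d a t' B ≤ kap d a t B := by
  obtain ⟨c, h1, h2⟩ := hc.exists_kap ht B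
  rw [← h1]
  exact kap_le (evaln_mono h h2)

theorem le_four_mul_kap (hc : Cand d a) {t : ℕ} (ht : sA d a < t) (ht' : t < sB d a) {i : ℕ}
    (B : Blk i) : 264 ^ 2 ^ (i + 2) ≤ 4 * kap d a t B := by
  obtain ⟨c, h1, h2⟩ := hc.exists_kap ht B
  have h3 := hc.four_mul_kap_le ht B
  have h4 := pow_le_four_mul_gam (i + 2)
  have h5 : (269 : ℕ) ^ 2 ^ (i + 2) ≤ 272 ^ 2 ^ (i + 2) := Nat.pow_le_pow_left (by norm_num) _
  rw [← h1] at h3 ⊢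
  exact (hc.blk_lower ht' B (by rw [show i + 3 = i + 2 + 1 from rfl]; omega) h2).2

end Cand

/-- The value of a lump, i.e. of a tree of blocks. -/
def lumpVal (d a : ℕ) {i k : ℕ} (P : Tr (Blk i) k) : ℕ := P.val (Blk.val d a)

namespace Cand

variable {d a : ℕ}

theorem deep_lumpVal {t : ℕ} (ht : t < sB d a) {i k : ℕ} (P : Tr (Blk i) k) :
    Deep t (i + 2 + k) (lumpVal d a P) := by
  induction k with
  | zero => exact deep_val ht P
  | succ k ih => exact ⟨_, _, rfl, .inl (ih P.1)⟩

theorem lump_lower (hc : Cand d a) {t : ℕ} (ht' : t < sB d a) {i k : ℕ} (P : Tr (Blk i) k)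
    {c : Code} {s : ℕ} (hlt : enc c < gam (i + 3 + k))
    (h : evaln t c s = some (lumpVal d a P)) : P.cost (kap d a t) ≤ enc c := by
  induction k generalizing c with
  | zero =>
    obtain ⟨rfl, -⟩ := hc.blk_lower ht' P hlt h
    exact kap_le h
  | succ k ih =>
    obtain ⟨f, g, x, y, rfl, hxy, hf, hg, hf4, hg4⟩ := (deep_lumpVal ht' P).pair_of_lt h
      (by rwa [show i + 2 + (k + 1) + 1 = i + 3 + (k + 1) by omega])
    rw [show i + 2 + (k + 1) = i + 3 + k by omega] at hf4 hg4
    obtain ⟨rfl, rfl⟩ := Nat.pair_eq_pair.1 hxy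
    rw [enc_pair]
    have h1 := ih P.1 hf4 hf
    have h2 := ih P.2 hg4 hg
    rw [Tr.cost_succ]
    have := pair_mono h1 h2
    omega

theorem lump_cost_le (hc : Cand d a) {t : ℕ} (ht : sA d a < t) {i k : ℕ} (P : Tr (Blk i) k) :
    4 * P.cost (kap d a t) + 5 ≤ 269 ^ 2 ^ (i + 2 + k) := by
  have := Tr.cost_le (hc.four_mul_kap_le ht) P
  rwa [← pow_mul, ← pow_add] at this

/-- Before the second seed is available, the cost of a lump bounds every code producing it. -/
theorem cost_le_enc (hc : Cand d a) {t : ℕ} (ht : sA d a < t) (ht' : t < sB d a) {i k : ℕ}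
    (P : Tr (Blk i) k) {c : Code} {s : ℕ} (h : evaln t c s = some (lumpVal d a P)) :
    P.cost (kap d a t) ≤ enc c := by
  by_cases hlt : enc c < gam (i + 3 + k)
  · exact hc.lump_lower ht' P hlt h
  · have h3 := hc.lump_cost_le ht P
    have h4 := pow_le_four_mul_gam (i + 2 + k)
    have h5 : (269 : ℕ) ^ 2 ^ (i + 2 + k) ≤ 272 ^ 2 ^ (i + 2 + k) :=
      Nat.pow_le_pow_left (by norm_num) _
    rw [show i + 2 + k + 1 = i + 3 + k by omega] at h4
    omega

/-- The first seed allows a code of exactly the cost of the lump. -/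
theorem exists_enc_eq_cost (hc : Cand d a) {t : ℕ} (ht : sA d a < t) {i k : ℕ} (P : Tr (Blk i) k) :
    ∃ c, enc c = P.cost (kap d a t) ∧ evaln t c (sA d a) = some (lumpVal d a P) := by
  choose C h1 h2 using hc.exists_kap ht (i := i)
  refine ⟨P.code C, ?_, Tr.evaln_code h2 P⟩
  rw [Tr.enc_code]
  simp only [h1]

/-- The second seed allows a cheap code. -/
theorem exists_enc_le_of_sB (hc : Cand d a) {t : ℕ} (ht : sB d a < t) {i k : ℕ} (P : Tr (Blk i) k) :
    ∃ c, 4 * enc c + 5 ≤ 261 ^ 2 ^ (i + 2 + k) ∧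
      evaln t c (sB d a) = some (lumpVal d a P) := by
  refine ⟨P.code fun B => B.toTr.code codeB, ?_,
    Tr.evaln_code (fun B => Tr.evaln_code (hc.evaln_codeB ht) B.toTr) P⟩
  rw [Tr.enc_code, pow_add, pow_mul]
  refine Tr.cost_le (fun B => ?_) P
  rw [Tr.enc_code]
  exact Tr.cost_le enc_codeB_le _

end Cand

/-- A Ramsey-type statement for antitone functions of bounded variation: one can pass to a subset
on which each of them is constant. -/
theorem exists_homogeneous {m : ℕ} (V : ℕ) (φ : ℕ → ℕ → ℕ)
    (hanti : ∀ i i' j, i ≤ i' → i' < j → j < m ^ 2 ^ V → φ j i' ≤ φ j i)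
    (hvar : ∀ i i' j, i ≤ i' → i' < j → j < m ^ 2 ^ V → φ j i ≤ φ j i' + V) :
    ∃ e : ℕ → ℕ, (∀ r s, r < s → s < m → e r < e s) ∧ (∀ r < m, e r < m ^ 2 ^ V) ∧
      ∀ i i' j, i ≤ i' → i' < j → j < m → φ (e j) (e i) = φ (e j) (e i') := by
  induction V generalizing φ with
  | zero =>
    rw [pow_zero, pow_one] at *
    exact ⟨id, fun _ _ h _ => h, fun _ h => h, fun i i' j h1 h2 h3 =>
      le_antisymm (by simpa using hvar i i' j h1 h2 h3) (hanti i i' j h1 h2 h3)⟩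
  | succ V ih =>
    rw [pow_succ 2 V, pow_mul] at *
    set L := m ^ 2 ^ V with hL
    have hmL : m ≤ L := Nat.le_self_pow (by positivity) m
    have hlt : ∀ b r, b < L → r < L → b * L + r < L ^ 2 := fun b r hb hr => by nlinarith
    by_cases hconst : ∃ b < L, ∀ i i' j, i ≤ i' → i' < j → j < L →
        φ (b * L + j) (b * L + i) = φ (b * L + j) (b * L + i')
    · obtain ⟨b, hb, h⟩ := hconst
      exact ⟨fun r => b * L + r, fun r s hrs _ => by simpa using hrs,
        fun r hr => hlt b r hb (hr.trans_le hmL),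
        fun i i' j h1 h2 h3 => h i i' j h1 h2 (h3.trans_le hmL)⟩
    · push Not at hconst
      choose! i i' j h1 h2 h3 h4 using hconst
      have mono : ∀ b c r, b < c → r < L → b * L + r < c * L := fun b c r hb hr => by nlinarith
      obtain ⟨e, he1, he2, he3⟩ := ih (fun c b => φ (c * L + j c) (b * L + j b))
        (fun b b' c hb hb' hc => hanti _ _ _ (by
          rcases hb.eq_or_lt with rfl | hb
          · exact le_rfl
          · have := mono b b' (j b) hb (h3 b (by omega)); omega)
          ((mono b' c _ hb' (h3 b' (by omega))).trans_le (by omega)) (hlt _ _ hc (h3 c hc)))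
        (fun b b' c hb hb' hc => by
          have hj := hlt c (j c) hc (h3 c hc)
          have e1 := mono b c _ (by omega) (h3 b (by omega))
          have e2 := mono b' c _ (by omega) (h3 b' (by omega))
          have a1 := h1 c hc
          have a2 := h2 c hc
          have a4 := h4 c hc
          have v := hvar (b * L + j b) (c * L + i' c) (c * L + j c) (by omega) (by omega) hj
          have w := hanti (c * L + i c) (c * L + i' c) (c * L + j c) (by omega) (by omega) hj
          have u := hanti (b' * L + j b') (c * L + i c) (c * L + j c) (by omega) (by omega) hj
          omega)
      refine ⟨fun r => e r * L + j (e r), fun r s hrs hs => ?_, fun r hr => ?_, he3⟩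
      · exact (mono _ _ _ (he1 r s hrs hs) (h3 _ (he2 r (hrs.trans hs)))).trans_le (by simp)
      · exact hlt _ _ (he2 r hr) (h3 _ (he2 r hr))

/-- Passing to a subset on which a bounded antitone family of functions is constant. -/
theorem exists_same_function (β : Type) [Fintype β] (v : ℕ) :
    ∃ C E : ℕ, 0 < C ∧ 0 < E ∧ ∀ m : ℕ, 0 < m → ∀ f : ℕ → ℕ → β → ℕ,
      (∀ i i' j B, i ≤ i' → i' < j → j < (C * m) ^ E → f j i' B ≤ f j i B) →
      (∀ i j B, i < j → j < (C * m) ^ E → f j i B ≤ v) →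
      ∃ (e : ℕ → ℕ) (g : β → ℕ), (∀ r s, r < s → s ≤ m → e r < e s) ∧
        (∀ r ≤ m, e r < (C * m) ^ E) ∧ ∀ i j, i < j → j ≤ m → f (e j) (e i) = g := by
  classical
  set F := Fintype.card (β → Fin (v + 1)) with hF
  refine ⟨F + 1, 2 ^ (Fintype.card β * v), by omega, by positivity, fun m hm f hanti hbd => ?_⟩
  have hm1 : 0 < (F + 1) * m := by positivity
  obtain ⟨e, he1, he2, he3⟩ := exists_homogeneous (m := (F + 1) * m) (Fintype.card β * v)
    (fun j i => ∑ B, f j i B)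
    (fun i i' j h1 h2 h3 => Finset.sum_le_sum fun B _ => hanti i i' j B h1 h2 h3)
    (fun i i' j h1 h2 h3 => by
      refine (Finset.sum_le_card_nsmul Finset.univ _ v fun B _ =>
        hbd i j B (by omega) h3).trans ?_
      simp)
  have key : ∀ i j, i < j → j < (F + 1) * m → f (e j) (e i) = f (e j) (e 0) := by
    intro i j hij hj
    have hle : ∀ B ∈ Finset.univ, f (e j) (e i) B ≤ f (e j) (e 0) B := by
      intro B _
      rcases Nat.eq_zero_or_pos i with rfl | hi
      · exact le_rfl
      · exact hanti _ _ _ B (he1 0 i hi (by omega)).le (he1 i j hij hj) (he2 j hj)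
    have := (Finset.sum_eq_sum_iff_of_le hle).1 (he3 0 i j (Nat.zero_le _) hij hj).symm
    exact funext fun B => this B (Finset.mem_univ B)
  obtain ⟨y, -, hy⟩ := Finset.exists_le_card_fiber_of_mul_le_card_of_maps_to
    (s := Finset.Icc 1 (F * m)) (t := (Finset.univ : Finset (β → Fin (v + 1))))
    (f := fun r B => Fin.ofNat (v + 1) (f (e r) (e 0) B)) (n := m)
    (fun _ _ => Finset.mem_univ _)
    (by
      have : 0 < F := Fintype.card_pos
      exact ⟨fun _ => 0, Finset.mem_univ _⟩)
    (by rw [Finset.card_univ, ← hF]; simp)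
  obtain ⟨S, hS, hcard⟩ := Finset.exists_subset_card_eq hy
  have hmem : ∀ r : Fin m, 1 ≤ S.orderEmbOfFin hcard r ∧ S.orderEmbOfFin hcard r ≤ F * m ∧
      ∀ B, f (e (S.orderEmbOfFin hcard r)) (e 0) B = y B := by
    intro r
    have h := hS (S.orderEmbOfFin_mem hcard r)
    rw [Finset.mem_filter, Finset.mem_Icc] at h
    refine ⟨h.1.1, h.1.2, fun B => ?_⟩
    rw [← h.2]
    have hlt : S.orderEmbOfFin hcard r < (F + 1) * m := by nlinarith [h.1.2]
    have := hbd (e 0) (e (S.orderEmbOfFin hcard r)) B (he1 _ _ (by omega) hlt) (he2 _ hlt)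
    simp [Fin.ofNat, Nat.mod_eq_of_lt (Nat.lt_succ_of_le this)]
  let q : ℕ → ℕ := fun r => if h : 0 < r ∧ r ≤ m then S.orderEmbOfFin hcard ⟨r - 1, by omega⟩ else 0
  have hq : ∀ r, 0 < r → r ≤ m → ∃ x : Fin m, x.1 = r - 1 ∧ q r = S.orderEmbOfFin hcard x :=
    fun r h1 h2 => ⟨⟨r - 1, by omega⟩, rfl, dif_pos ⟨h1, h2⟩⟩
  have hq0 : q 0 = 0 := dif_neg (by simp)
  have hqlt : ∀ r ≤ m, q r < (F + 1) * m := by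
    intro r hr
    rcases Nat.eq_zero_or_pos r with rfl | h0
    · rw [hq0]; exact hm1
    · obtain ⟨x, -, hx⟩ := hq r h0 hr
      rw [hx]
      have := (hmem x).2.1
      nlinarith
  have hqmono : ∀ r s, r < s → s ≤ m → q r < q s := by
    intro r s hrs hs
    obtain ⟨x, hx1, hx⟩ := hq s (by omega) hs
    rcases Nat.eq_zero_or_pos r with rfl | h0
    · rw [hq0, hx]; exact (hmem x).1
    · obtain ⟨x', hx1', hx'⟩ := hq r h0 (by omega)
      rw [hx, hx']
      exact (S.orderEmbOfFin hcard).strictMono (Fin.lt_def.2 (by omega))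
  refine ⟨fun r => e (q r), fun B => y B, fun r s hrs hs => he1 _ _ (hqmono r s hrs hs) (hqlt s hs),
    fun r hr => he2 _ (hqlt r hr), fun i j hij hj => ?_⟩
  obtain ⟨x, -, hx⟩ := hq j (by omega) hj
  dsimp only
  rw [key _ _ (hqmono i j hij hj) (hqlt j hj), hx]
  exact funext (hmem x).2.2

/-- Few values of `c` lie in a short interval: at most `K * l ^ (r / p)` in length `l`. -/
def Sparse {A : Type} (c : A → ℕ) (p r K : ℕ) : Prop :=
  ∀ (T : Finset A) (x l : ℕ), 1 ≤ l → (∀ a ∈ T, x ≤ c a ∧ c a ≤ x + l) →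
    T.card ^ p ≤ K ^ p * l ^ r

theorem sparse_of_card {A : Type} [Fintype A] (c : A → ℕ) (p r : ℕ) :
    Sparse c p r (Fintype.card A) := fun T x l hl _ =>
  (Nat.pow_le_pow_left (Finset.card_le_univ T) p).trans
    (Nat.le_mul_of_pos_right _ (by positivity))

theorem Sparse.card_ordered_le {A : Type} [Fintype A] {c : A → ℕ} (hc : c.Injective)
    {p r K lo : ℕ} (hlo0 : 0 < lo) (hlo : ∀ a, lo ≤ c a) (hrp : r ≤ p)
    (hcard : Fintype.card A ^ p ≤ lo ^ r) (hs : Sparse c p r K)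
    (ε : ℕ) (T : Finset (A × A)) (x l : ℕ) (hl : 1 ≤ l)
    (hT : ∀ q ∈ T, ε * c q.1 + c q.2 ≤ 2 * c q.1 ∧
      x ≤ 4 * (c q.1 ^ 2 + ε * c q.1 + c q.2) + 4 ∧
      4 * (c q.1 ^ 2 + ε * c q.1 + c q.2) + 4 ≤ x + l) :
    T.card ^ p ≤ (2 * K) ^ p * l ^ r := by
  classical
  rcases T.eq_empty_or_nonempty with rfl | hne
  · rcases Nat.eq_zero_or_pos p with rfl | hp
    · simp only [pow_zero, one_mul]; exact Nat.one_le_pow _ _ hl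
    · simp [zero_pow hp.ne']
  set I := T.image Prod.fst with hI
  have hIne : I.Nonempty := hne.image _
  obtain ⟨a₀, ha₀, hmin⟩ := Finset.exists_min_image I c hIne
  obtain ⟨a₁, ha₁, hmax⟩ := Finset.exists_max_image I
    (fun a => (T.filter fun q => q.1 = a).card) hIne
  have hT_le : T.card ≤ (T.filter fun q => q.1 = a₁).card * I.card :=
    Finset.card_le_mul_card_image T _ fun a ha => hmax a ha
  obtain ⟨q₀, hq₀, rfl⟩ := Finset.mem_image.1 ha₀
  have hsq : ∀ a ∈ I, 4 * c a ^ 2 ≤ 4 * (c q₀.1 ^ 2 + 2 * c q₀.1) + l := by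
    intro a ha
    obtain ⟨q, hq, rfl⟩ := Finset.mem_image.1 ha
    obtain ⟨-, -, h1⟩ := hT q hq
    obtain ⟨h2, h3, -⟩ := hT q₀ hq₀
    have := Nat.zero_le (ε * c q.1)
    omega
  have hinj : Set.InjOn Prod.snd ((T.filter fun q => q.1 = a₁ : Finset (A × A)) : Set (A × A)) := by
    intro q hq q' hq' h
    rw [Finset.mem_coe, Finset.mem_filter] at hq hq'
    exact Prod.ext (hq.2.trans hq'.2.symm) h
  rcases le_or_gt l lo with hll | hll
  · have hI2 : I.card ≤ 2 := by
      have : I.card ≤ (Finset.Icc (c q₀.1) (c q₀.1 + 1)).card := by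
        refine Finset.card_le_card_of_injOn c (fun a ha => ?_) hc.injOn
        rw [Finset.mem_coe, Finset.mem_Icc]
        refine ⟨hmin a ha, ?_⟩
        by_contra! hlt
        have h1 := hsq a ha
        have h2 := Nat.pow_le_pow_left (Nat.succ_le_of_lt hlt) 2
        have h3 := hlo q₀.1
        simp only [Nat.succ_eq_add_one] at h2
        nlinarith
      rw [Nat.card_Icc] at this
      omega
    have hfib : (T.filter fun q => q.1 = a₁).card ^ p ≤ K ^ p * l ^ r := by
      rw [← Finset.card_image_of_injOn hinj]
      refine hs _ ((x - 1) / 4 - (c a₁ ^ 2 + ε * c a₁)) l hl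
        fun a ha => ?_
      obtain ⟨q, hq, rfl⟩ := Finset.mem_image.1 ha
      rw [Finset.mem_filter] at hq
      obtain ⟨hq, rfl⟩ := hq
      obtain ⟨-, h1, h2⟩ := hT q hq
      generalize c q.1 ^ 2 + ε * c q.1 = z at *
      omega
    calc T.card ^ p ≤ ((T.filter fun q => q.1 = a₁).card * 2) ^ p :=
          Nat.pow_le_pow_left (hT_le.trans (Nat.mul_le_mul_left _ hI2)) p
      _ = (T.filter fun q => q.1 = a₁).card ^ p * 2 ^ p := mul_pow _ _ _
      _ ≤ K ^ p * l ^ r * 2 ^ p := Nat.mul_le_mul_right _ hfib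
      _ = (2 * K) ^ p * l ^ r := by rw [mul_pow]; ring
  · set l' := l / (8 * lo) + 1 with hl'
    have hl8 : l < 8 * lo * l' := Nat.lt_mul_div_succ l (by positivity)
    have hl2 : lo * l' ≤ 2 * l := by
      have := Nat.mul_div_le l (8 * lo)
      rw [hl']
      nlinarith
    have hIc : I.card ^ p ≤ K ^ p * l' ^ r := by
      refine hs I (c q₀.1) l' (Nat.succ_pos _) fun a ha => ⟨hmin a ha, ?_⟩
      by_contra! hlt
      have h1 := hsq a ha
      have h2 := Nat.pow_le_pow_left (Nat.succ_le_of_lt hlt) 2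
      have h3 := hlo q₀.1
      have h4 := Nat.mul_le_mul_right l' h3
      simp only [Nat.succ_eq_add_one] at h2
      nlinarith
    have hfib : (T.filter fun q => q.1 = a₁).card ≤ Fintype.card A := by
      rw [← Finset.card_image_of_injOn hinj]
      exact Finset.card_le_univ _
    calc T.card ^ p ≤ (Fintype.card A * I.card) ^ p :=
          Nat.pow_le_pow_left (hT_le.trans (Nat.mul_le_mul_right _ hfib)) p
      _ = Fintype.card A ^ p * I.card ^ p := mul_pow _ _ _
      _ ≤ lo ^ r * (K ^ p * l' ^ r) := Nat.mul_le_mul hcard hIc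
      _ = K ^ p * (lo * l') ^ r := by rw [mul_pow]; ring
      _ ≤ K ^ p * (2 * l) ^ r := by gcongr
      _ = K ^ p * l ^ r * 2 ^ r := by rw [mul_pow]; ring
      _ ≤ K ^ p * l ^ r * 2 ^ p := by gcongr; norm_num
      _ = (2 * K) ^ p * l ^ r := by rw [mul_pow]; ring

theorem Sparse.pair {A : Type} [Fintype A] {c : A → ℕ} (hc : c.Injective)
    {p r K lo : ℕ} (hlo0 : 0 < lo) (hlo : ∀ a, lo ≤ c a) (hrp : r ≤ p)
    (hcard : Fintype.card A ^ p ≤ lo ^ r) (hs : Sparse c p r K) :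
    Sparse (fun q : A × A => 4 * Nat.pair (c q.1) (c q.2) + 4) p r (4 * K) := by
  classical
  intro T x l hl hT
  have h1 := hs.card_ordered_le hc hlo0 hlo hrp hcard 1 (T.filter fun q => c q.2 ≤ c q.1) x l hl
    (fun q hq => by
      obtain ⟨hq, hle⟩ := Finset.mem_filter.1 hq
      have := hT q hq
      dsimp only at this
      rw [Nat.pair, if_neg (by omega), ← sq] at this
      rw [one_mul]
      exact ⟨by omega, this⟩)
  have h2 := hs.card_ordered_le hc hlo0 hlo hrp hcard 0
    ((T.filter fun q => ¬ c q.2 ≤ c q.1).map (Equiv.prodComm A A).toEmbedding) x l hl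
    (fun q hq => by
      obtain ⟨q, hq', rfl⟩ := Finset.mem_map.1 hq
      obtain ⟨hq, hle⟩ := Finset.mem_filter.1 hq'
      have := hT q hq
      dsimp only at this
      rw [Nat.pair, if_pos (by omega), ← sq] at this
      simp only [Equiv.coe_toEmbedding, Equiv.prodComm_apply, Prod.fst_swap, Prod.snd_swap]
      rw [zero_mul, add_zero]
      exact ⟨by omega, this⟩)
  rw [Finset.card_map] at h2
  have h3 := Finset.card_filter_add_card_filter_not (s := T) (fun q => c q.2 ≤ c q.1)
  rw [← h3]
  generalize (T.filter fun q => c q.2 ≤ c q.1).card = m at *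
  generalize (T.filter fun q => ¬ c q.2 ≤ c q.1).card = m' at *
  calc (m + m') ^ p ≤ (2 * max m m') ^ p := Nat.pow_le_pow_left (by omega) p
    _ = 2 ^ p * (max m m') ^ p := mul_pow _ _ _
    _ ≤ 2 ^ p * ((2 * K) ^ p * l ^ r) := by
        gcongr
        rcases max_choice m m' with h | h <;> rw [h] <;> assumption
    _ = (4 * K) ^ p * l ^ r := by
        rw [← mul_assoc, ← mul_pow]; congr 2; ring

theorem Tr.sparse_cost {β : Type} [Fintype β] {k : β → ℕ} (hk : k.Injective)
    {p r b : ℕ} (hrp : r ≤ p) (hb0 : 0 < b) (hb : ∀ x, b ^ p ≤ 4 * k x)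
    (hcard : 4 * Fintype.card β ≤ b ^ r) (h : ℕ) :
    Sparse (fun T : Tr β h => T.cost k) p r (4 ^ h * Fintype.card β) := by
  induction h with
  | zero =>
    rw [pow_zero, one_mul]
    exact sparse_of_card k p r
  | succ h ih =>
    rw [pow_succ, mul_comm (4 ^ h) 4, mul_assoc]
    have hb' : ∀ T : Tr β h, b ^ (p * 2 ^ h) ≤ 4 * T.cost k := fun T => by
      rw [pow_mul]; exact Tr.le_cost hb T
    obtain ⟨lo, hlo⟩ : ∃ lo, lo = (b ^ (p * 2 ^ h) + 3) / 4 := ⟨_, rfl⟩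
    have hpos : 0 < b ^ (p * 2 ^ h) := by positivity
    refine Sparse.pair (A := Tr β h) (lo := lo) (Tr.cost_injective hk) (by omega)
      (fun T => by have := hb' T; omega) hrp ?_ ih
    rw [Tr.card, ← pow_mul]
    have h4 : b ^ (p * 2 ^ h) ≤ 4 * lo := by omega
    have hp2 : r ≤ 2 ^ h * p := hrp.trans (Nat.le_mul_of_pos_left _ (by positivity))
    have : 4 ^ r * Fintype.card β ^ (2 ^ h * p) ≤ 4 ^ r * lo ^ r := by
      calc 4 ^ r * Fintype.card β ^ (2 ^ h * p)
          ≤ 4 ^ (2 ^ h * p) * Fintype.card β ^ (2 ^ h * p) := by gcongr; norm_num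
        _ = (4 * Fintype.card β) ^ (2 ^ h * p) := (mul_pow _ _ _).symm
        _ ≤ (b ^ r) ^ (2 ^ h * p) := by gcongr
        _ = (b ^ (p * 2 ^ h)) ^ r := by rw [← pow_mul, ← pow_mul]; congr 1; ring
        _ ≤ (4 * lo) ^ r := by gcongr
        _ = 4 ^ r * lo ^ r := mul_pow _ _ _
    exact Nat.le_of_mul_le_mul_left this (by positivity)

/-- A large finite type with a sparse injective cost function has elements with well separated
costs. -/
theorem Sparse.exists_separated {A : Type} [Fintype A] {c : A → ℕ} {p r K : ℕ} (hp : p ≠ 0)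
    (hs : Sparse c p r K) (m ρ : ℕ) (hρ : 1 ≤ ρ)
    (hlt : m ^ p * (K ^ p * ρ ^ r) < Fintype.card A ^ p) :
    ∃ P : ℕ → A, ∀ i j, i < j → j ≤ m → c (P j) + ρ < c (P i) := by
  classical
  have hne : (Finset.univ : Finset A).Nonempty := by
    rw [← Finset.card_pos, Finset.card_univ]
    refine Nat.pos_of_ne_zero fun h => ?_
    rw [h, zero_pow hp] at hlt
    omega
  set win : A → Finset A := fun a => Finset.univ.filter fun a' => c a ≤ c a' ∧ c a' ≤ c a + ρ
    with hwin
  obtain ⟨a₁, -, hmax⟩ := Finset.exists_max_image Finset.univ (fun a => (win a).card) hne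
  have hW : (win a₁).card ^ p ≤ K ^ p * ρ ^ r :=
    hs _ (c a₁) ρ hρ fun a ha => (Finset.mem_filter.1 ha).2
  have H : ∀ (m : ℕ) (S : Finset A), m * (win a₁).card < S.card →
      ∃ P : ℕ → A, (∀ j ≤ m, P j ∈ S) ∧ ∀ i j, i < j → j ≤ m → c (P j) + ρ < c (P i) := by
    intro m
    induction m with
    | zero =>
      intro S hS
      obtain ⟨a, ha⟩ := Finset.card_pos.1 (by omega : 0 < S.card)
      exact ⟨fun _ => a, fun _ _ => ha, fun i j h1 h2 => by omega⟩
    | succ m ih =>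
      intro S hS
      have hS0 : S.Nonempty := Finset.card_pos.1 (by omega)
      obtain ⟨a, ha, hmin⟩ := Finset.exists_min_image S c hS0
      have h1 := Finset.card_filter_add_card_filter_not (s := S) (fun a' => c a' ≤ c a + ρ)
      have h2 : (S.filter fun a' => c a' ≤ c a + ρ).card ≤ (win a).card := by
        refine Finset.card_le_card fun a' ha' => ?_
        rw [Finset.mem_filter] at ha'
        exact Finset.mem_filter.2 ⟨Finset.mem_univ _, hmin a' ha'.1, ha'.2⟩
      have h3 := hmax a (Finset.mem_univ a)
      obtain ⟨P, hP1, hP2⟩ := ih (S.filter fun a' => ¬ c a' ≤ c a + ρ) (by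
        rw [Nat.succ_mul] at hS
        omega)
      refine ⟨fun j => if j ≤ m then P j else a, fun j _ => ?_, fun i j hij hj => ?_⟩
      · dsimp only
        split_ifs with h
        · exact (Finset.mem_filter.1 (hP1 j h)).1
        · exact ha
      · dsimp only
        rw [if_pos (by omega : i ≤ m)]
        split_ifs with h
        · exact hP2 i j hij h
        · exact not_le.1 (Finset.mem_filter.1 (hP1 i (by omega))).2
  obtain ⟨P, -, hP⟩ := H m Finset.univ (by
    rw [Finset.card_univ]
    refine lt_of_pow_lt_pow_left₀ p (Nat.zero_le _) ?_
    rw [mul_pow]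
    exact (Nat.mul_le_mul_left _ hW).trans_lt hlt)
  exact ⟨P, hP⟩

theorem Tr.val_lt {α : Type} {f : α → ℕ} {m : ℕ} (hf : ∀ x, f x + 1 ≤ m) :
    ∀ {h : ℕ} (T : Tr α h), T.val f + 1 ≤ m ^ 2 ^ h
  | 0, x => by rw [pow_zero, pow_one]; exact hf x
  | h + 1, x => by
    rw [pow_succ 2 h, pow_mul]
    have h1 := Tr.val_lt hf x.1
    have h2 := Tr.val_lt hf x.2
    refine (Nat.pair_lt_max_add_one_sq _ _).trans_le (Nat.pow_le_pow_left ?_ 2)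
    rcases max_choice (Tr.val f x.1) (Tr.val f x.2) with h | h <;> rw [h] <;> assumption

/-- The tree of height `h` whose leaves are `s, …, s + 2 ^ h - 1`. -/
def lab : ∀ h : ℕ, ℕ → Tr ℕ h
  | 0, s => s
  | h + 1, s => (lab h s, lab h (s + 2 ^ h))

theorem above_lab (f : ℕ → ℕ) {h s j : ℕ} (h1 : s ≤ j) (h2 : j < s + 2 ^ h) :
    Above h ((lab h s).val f) (f j) := by
  induction h generalizing s with
  | zero =>
    obtain rfl : j = s := by rw [pow_zero] at h2; omega
    rfl
  | succ h ih =>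
    rw [pow_succ] at h2
    refine ⟨_, _, rfl, ?_⟩
    rcases lt_or_ge j (s + 2 ^ h) with h3 | h3
    · exact .inl (ih h1 h3)
    · exact .inr (ih h3 (by omega))

theorem Above.trans {D D' y p q : ℕ} (h : Above D y p) (h' : Above D' p q) :
    Above (D' + D) y q := by
  induction D generalizing y with
  | zero => obtain rfl := h; exact h'
  | succ D ih =>
    obtain ⟨a, b, rfl, h1 | h1⟩ := h
    · exact ⟨_, _, rfl, .inl (ih h1)⟩
    · exact ⟨_, _, rfl, .inr (ih h1)⟩

/-- A code computing the number `v` from the input `0`. -/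
def numCode : ℕ → ℕ → Code
  | 0, v => if v = 0 then zero else succ
  | J + 1, v => pair (numCode J v.unpair.1) (numCode J v.unpair.2)

theorem evaln_numCode {t : ℕ} (ht : 0 < t) {J v : ℕ} (hv : v < 2 ^ 2 ^ J) :
    evaln t (numCode J v) 0 = some v := by
  induction J generalizing v with
  | zero =>
    rw [pow_zero, pow_one] at hv
    rw [numCode]
    split_ifs with h
    · rw [h]; exact evaln_zero_some ht
    · obtain rfl : v = 1 := by omega
      exact evaln_succ_some ht
  | succ J ih =>
    rw [pow_succ 2 J, pow_mul] at hv
    have hp := Nat.pair_unpair v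
    have h1 := sq_left_le_pair v.unpair.1 v.unpair.2
    have h2 := sq_right_le_pair v.unpair.1 v.unpair.2
    rw [hp] at h1 h2
    conv_rhs => rw [← hp]
    exact evaln_pair_some (ih (lt_of_pow_lt_pow_left₀ 2 (Nat.zero_le _) (h1.trans_lt hv)))
      (ih (lt_of_pow_lt_pow_left₀ 2 (Nat.zero_le _) (h2.trans_lt hv)))

theorem enc_numCode_le (J v : ℕ) : 4 * enc (numCode J v) + 5 ≤ 9 ^ 2 ^ J := by
  induction J generalizing v with
  | zero =>
    rw [numCode]
    split_ifs <;> simp [enc_zero, enc_succ]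
  | succ J ih =>
    rw [pow_succ 2 J, pow_mul, numCode, enc_pair]
    exact four_mul_pair_le (ih _) (ih _)

/-- A code computing `(n + 1) ^ 2 ^ h` from `n`. -/
def powCode : ℕ → Code
  | 0 => succ
  | h + 1 => pair zero (powCode h)

theorem evaln_powCode {t n : ℕ} (ht : n < t) (h : ℕ) :
    evaln t (powCode h) n = some ((n + 1) ^ 2 ^ h) := by
  induction h with
  | zero => simpa [powCode] using evaln_succ_some ht
  | succ h ih =>
    rw [powCode, pow_succ 2 h, pow_mul]
    have hpos : 0 < (n + 1) ^ 2 ^ h := by positivity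
    have : Nat.pair 0 ((n + 1) ^ 2 ^ h) = ((n + 1) ^ 2 ^ h) ^ 2 := by
      rw [Nat.pair, if_pos hpos, sq, add_zero]
    rw [← this]
    exact evaln_pair_some (evaln_zero_some ht) ih

theorem enc_powCode_le (h : ℕ) : 4 * enc (powCode h) + 5 ≤ 9 ^ 2 ^ h := by
  induction h with
  | zero => simp [powCode, enc_succ]
  | succ h ih =>
    rw [pow_succ 2 h, pow_mul, powCode, enc_pair, enc_zero]
    exact four_mul_pair_le (by omega) ih

theorem unpair_iterate_lumpVal (d a : ℕ) {i k : ℕ} (P : Tr (Blk i) k) :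
    (fun y => (Nat.unpair y).1)^[i + 2 + k] (lumpVal d a P) = d := by
  have hB : ∀ {i : ℕ} (B : Blk i), (fun y => (Nat.unpair y).1)^[i + 2] (B.val d a) = d := by
    intro i B
    induction i with
    | zero => simp [Blk.val_zero]
    | succ i ih =>
      rw [show i + 1 + 2 = (i + 2) + 1 by ring, Function.iterate_succ_apply, Blk.val_succ]
      simpa using ih B.1
  induction k with
  | zero => exact hB P
  | succ k ih =>
    rw [show i + 2 + (k + 1) = (i + 2 + k) + 1 by ring, Function.iterate_succ_apply, lumpVal,
      Tr.val_succ]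
    simpa [lumpVal] using ih P.1

/-- Some number in a long enough interval is not the leftmost leaf of an output of a short code. -/
theorem exists_avoiding (K D₀ N : ℕ) : ∃ d, D₀ ≤ d ∧ d ≤ D₀ + N ∧
    ∀ c : Code, enc c < N → ∀ t y, evaln t c 0 = some y →
      (fun y => (Nat.unpair y).1)^[K] y ≠ d := by
  classical
  by_contra! h
  choose! c h1 t y h2 h3 using h
  have hinj : Set.InjOn (fun d => enc (c d)) (Finset.Icc D₀ (D₀ + N) : Set ℕ) := by
    intro d hd d' hd' hdd
    rw [Finset.mem_coe, Finset.mem_Icc] at hd hd'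
    have e : c d = c d' := enc_injective hdd
    have e1 := evaln_mono (le_max_left (t d) (t d')) (h2 d hd.1 hd.2)
    have e2 := evaln_mono (le_max_right (t d) (t d')) (h2 d' hd'.1 hd'.2)
    rw [e] at e1
    have : y d = y d' := Option.some_inj.1 ((Option.mem_def.1 e1).symm.trans e2)
    rw [← h3 d hd.1 hd.2, ← h3 d' hd'.1 hd'.2, this]
  have hcard := Finset.card_le_card_of_injOn (s := Finset.Icc D₀ (D₀ + N)) (t := Finset.range N)
    (fun d => enc (c d)) (fun d hd => by
      rw [Finset.mem_coe, Finset.mem_Icc] at hd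
      rw [Finset.mem_coe, Finset.mem_range]
      exact h1 d hd.1 hd.2) hinj
  rw [Nat.card_Icc, Finset.card_range] at hcard
  omega

theorem two_mul_pow_le {b g q : ℕ} (hb : 0 < b) (hq : b ≤ q * g) : 2 * b ^ q ≤ (b + g) ^ q := by
  have h : ∀ q, b ^ (q + 1) + (q + 1) * g * b ^ q ≤ (b + g) ^ (q + 1) := by
    intro q
    induction q with
    | zero => simp
    | succ q ih =>
      have := Nat.mul_le_mul_right (b + g) ih
      rw [pow_succ (b + g) (q + 1)]
      refine le_trans ?_ this
      have e : (b ^ (q + 1) + (q + 1) * g * b ^ q) * (b + g) =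
        b ^ (q + 1 + 1) + (q + 1 + 1) * g * b ^ (q + 1) + (q + 1) * g * b ^ q * g := by ring
      rw [e]
      exact Nat.le_add_right _ _
  cases q with
  | zero =>
    omega
  | succ q =>
    refine le_trans ?_ (h q)
    have := Nat.mul_le_mul_right (b ^ q) hq
    rw [pow_succ' b q] at *
    omega

/-- The common pairing structure repeated over a value. -/
def dup (r p : ℕ) : ℕ := (lab r 0).val fun _ => p

theorem above_dup (r p : ℕ) : Above r (dup r p) p :=
  above_lab (fun _ => p) (Nat.zero_le 0) (by positivity)

theorem exists_code_dup {t s p M r : ℕ} {c : Code} (hM : 4 * enc c + 5 ≤ M)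
    (h : evaln t c s = some p) :
    ∃ c', 4 * enc c' + 5 ≤ M ^ 2 ^ r ∧ evaln t c' s = some (dup r p) := by
  refine ⟨(lab r 0).code fun _ => c, ?_, Tr.evaln_code (fun _ => h) _⟩
  rw [Tr.enc_code]
  exact Tr.cost_le (fun _ => hM) _

/-- The data from which the string is assembled: `m + 1` candidates with the same cost function
`g` and lumps with separated costs. -/
structure Setup (i k r D m d z ρ : ℕ) (a : ℕ → ℕ) (g : Blk i → ℕ) (P : ℕ → Tr (Blk i) k) :
    Prop where
  cand : ∀ j ≤ m, Cand d (a j)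
  gap : ∀ s j, s < j → j ≤ m → a s + 1 < a j
  kap_eq : ∀ s j, s < j → j ≤ m → kap d (a j) (sB d (a s) + 1) = g
  avoid : ∀ (c : Code) (t y : ℕ), evaln t c 0 = some y →
    (fun y => (Nat.unpair y).1)^[i + 2 + k] y = d →
    ∀ e, 4 * e + 5 ≤ 269 ^ 2 ^ (i + 2 + k) → psi e ≤ enc c
  lt_z : ww d + 1 ≤ z
  z_le : z ≤ ww d ^ 2
  sq_z_le : z ^ 2 ≤ 2 ^ 2 ^ r
  m_le : m ≤ 2 ^ D
  ρ_pos : 1 ≤ ρ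
  sep : ∀ s j, s < j → j ≤ m → (P j).cost g + ρ < (P s).cost g
  ρ_large : 269 ^ 2 ^ (i + 2 + k) ≤ 2 ^ (D + r + 2) * ρ

namespace Setup

variable {i k r D m d z ρ : ℕ} {a : ℕ → ℕ} {g : Blk i → ℕ} {P : ℕ → Tr (Blk i) k}

/-- The time bounds. -/
def time (d : ℕ) (a : ℕ → ℕ) (s : ℕ) : ℕ := sB d (a s) + 1

/-- The value of a group. -/
def grp (r m d : ℕ) (a : ℕ → ℕ) (P : ℕ → Tr (Blk i) k) (s : ℕ) : ℕ :=
  dup r (lumpVal d (a (min (s + 1) m)) (P (min (s + 1) m)))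

/-- The combination of all groups. -/
def front (r D m d : ℕ) (a : ℕ → ℕ) (P : ℕ → Tr (Blk i) k) : ℕ :=
  (lab D 0).val (grp r m d a P)

/-- The string. -/
def out (r D m d z : ℕ) (a : ℕ → ℕ) (P : ℕ → Tr (Blk i) k) : ℕ :=
  Nat.pair (front r D m d a P) (z ^ 2 ^ (D + r + (i + 2 + k) + 1))

theorem time_lt (S : Setup i k r D m d z ρ a g P) {s j : ℕ} (h : s < j) (hj : j ≤ m) :
    sA d (a j) < time d a s ∧ time d a s < sB d (a j) := by
  have h1 := S.cand s (h.le.trans hj)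
  have h2 := S.cand j hj
  have h3 := S.gap s j h hj
  have e1 := h1.sB_eq
  have e2 := h2.sB_eq
  have e3 := h2.sA_eq
  have h5 := h2.add_le
  have h6 := h2.uu_lt
  have h7 := h2.lt_uu
  unfold time uu at *
  omega

theorem lt_time (S : Setup i k r D m d z ρ a g P) {s j : ℕ} (h : j ≤ s) (hs : s ≤ m) :
    sB d (a j) < time d a s := by
  rcases h.eq_or_lt with rfl | h
  · exact Nat.lt_succ_self _
  · have h1 := S.cand s hs
    have h2 := S.cand j (h.le.trans hs)
    have h3 := S.gap j s h hs
    have e1 := h1.sB_eq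
    have e2 := h2.sB_eq
    unfold time uu at *
    omega

theorem sC_lt (S : Setup i k r D m d z ρ a g P) : sC d + 1 ≤ z ^ 2 := by
  have := Nat.pow_le_pow_left S.lt_z 2
  rw [sC_eq]
  linarith [show (ww d + 1) ^ 2 = ww d ^ 2 + 2 * ww d + 1 by ring]

theorem lumpVal_lt (S : Setup i k r D m d z ρ a g P) {j : ℕ} (hj : j ≤ m) (T : Tr (Blk i) k) :
    lumpVal d (a j) T + 1 ≤ (z ^ 2) ^ 2 ^ (i + 2 + k) := by
  have hl : ∀ x, letter d (a j) x + 1 ≤ z ^ 2 := by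
    intro x
    have h1 := (S.cand j hj).strictMono_letter.monotone (Fin.le_last x)
    have h2 := S.sC_lt
    change _ ≤ sC d at h1
    omega
  have h := Tr.val_lt (f := Blk.val d (a j)) (fun B => Tr.val_lt hl B.toTr) T
  rwa [← pow_mul, ← pow_add] at h

theorem front_lt (S : Setup i k r D m d z ρ a g P) :
    front r D m d a P < z ^ 2 ^ (D + r + (i + 2 + k) + 1) := by
  have h : ∀ s, grp r m d a P s + 1 ≤ ((z ^ 2) ^ 2 ^ (i + 2 + k)) ^ 2 ^ r := fun s =>
    Tr.val_lt (fun _ => S.lumpVal_lt (min_le_right _ _) _) _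
  have h1 := Tr.val_lt h (lab D 0)
  have e : ((((z ^ 2) ^ 2 ^ (i + 2 + k)) ^ 2 ^ r) ^ 2 ^ D) = z ^ 2 ^ (D + r + (i + 2 + k) + 1) := by
    simp only [← pow_mul, pow_add]; ring
  rw [e] at h1
  exact h1

theorem out_eq (S : Setup i k r D m d z ρ a g P) :
    out r D m d z a P = (z ^ 2 ^ (D + r + (i + 2 + k) + 1)) ^ 2 + front r D m d a P := by
  rw [out, Nat.pair, if_pos S.front_lt, sq]

theorem cost_bounds (S : Setup i k r D m d z ρ a g P) {s j : ℕ} (h : s < j) (hj : j ≤ m)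
    (T : Tr (Blk i) k) :
    264 ^ 2 ^ (i + 2 + k) ≤ 4 * T.cost g ∧ 4 * T.cost g + 5 ≤ 269 ^ 2 ^ (i + 2 + k) := by
  obtain ⟨h1, h2⟩ := S.time_lt h hj
  have hc := S.cand j hj
  rw [← S.kap_eq s j h hj]
  refine ⟨?_, hc.lump_cost_le h1 T⟩
  have := Tr.le_cost (hc.le_four_mul_kap h1 h2) T
  rwa [← pow_mul, ← pow_add] at this

theorem lower (S : Setup i k r D m d z ρ a g P) {s : ℕ} (hs : s < m) {c : Code}
    (h : evaln (time d a s) c 0 = some (out r D m d z a P)) :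
    (4 * (P (s + 1)).cost g) ^ 2 ^ (D + r + 2) ≤ 4 * enc c := by
  obtain ⟨h1, h2⟩ := S.time_lt (Nat.lt_succ_self s) hs
  have hc := S.cand (s + 1) hs
  have hk := S.kap_eq s (s + 1) (Nat.lt_succ_self s) hs
  have hA : Above (r + D + 1) (out r D m d z a P) (lumpVal d (a (s + 1)) (P (s + 1))) := by
    refine ⟨_, _, rfl, .inl ?_⟩
    have h3 := above_lab (grp r m d a P) (Nat.zero_le s)
      (show s < 0 + 2 ^ D by have := S.m_le; omega)
    refine h3.trans ?_
    rw [grp, min_eq_left (show s + 1 ≤ m from hs)]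
    exact above_dup _ _
  have hmin : ∀ c s', evaln (time d a s) c s' = some (lumpVal d (a (s + 1)) (P (s + 1))) →
      (P (s + 1)).cost g ≤ enc c := by
    intro c s' h'
    rw [← hk]
    exact hc.cost_le_enc h1 h2 _ h'
  have := hA.psi_succ_le ((Cand.deep_lumpVal h2 _).lt) hmin (fun c h' => S.avoid c _ _ h'
    (unpair_iterate_lumpVal _ _ _) _ (S.cost_bounds (Nat.lt_succ_self s) hs _).2) h
  have h3 := pow_le_four_mul_psi_iterate (le_refl (4 * (P (s + 1)).cost g)) (r + D + 1 + 1)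
  rw [show r + D + 1 + 1 = D + r + 2 by ring] at h3 this
  omega

theorem exists_code_lump (S : Setup i k r D m d z ρ a g P) {s j : ℕ} (hs : s < m) (hj : j ≤ m) :
    ∃ c seed, seed < z ^ 2 ∧ 4 * enc c + 5 ≤ 4 * (P (s + 1)).cost g + 5 ∧
      evaln (time d a s) c seed = some (lumpVal d (a j) (P j)) := by
  have hc := S.cand j hj
  have hz := S.sC_lt
  have h1 := hc.sB_lt
  have h2 := hc.sA_lt
  rcases lt_or_ge s j with h | h
  · obtain ⟨h3, h4⟩ := S.time_lt h hj
    obtain ⟨c, h5, h6⟩ := hc.exists_enc_eq_cost h3 (P j)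
    refine ⟨c, sA d (a j), by omega, ?_, h6⟩
    rw [h5]
    change 4 * Tr.cost (kap d (a j) (sB d (a s) + 1)) (P j) + 5 ≤ _
    rw [S.kap_eq s j h hj]
    rcases (Nat.succ_le_of_lt h).eq_or_lt with h7 | h7
    · rw [← h7]
    · have := S.sep (s + 1) j h7 hj
      omega
  · obtain ⟨c, h5, h6⟩ := hc.exists_enc_le_of_sB (S.lt_time h hs.le) (P j)
    refine ⟨c, sB d (a j), by omega, h5.trans ?_, h6⟩
    have h7 := (S.cost_bounds (Nat.lt_succ_self s) hs (P (s + 1))).1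
    have h8 : (261 : ℕ) ^ 2 ^ (i + 2 + k) ≤ 264 ^ 2 ^ (i + 2 + k) :=
      Nat.pow_le_pow_left (by norm_num) _
    omega

theorem upper (S : Setup i k r D m d z ρ a g P) {s : ℕ} (hs : s < m) :
    ∃ c, 4 * enc c + 5 ≤ (4 * (P (s + 1)).cost g + 5) ^ 2 ^ (D + r + 2) ∧
      evaln (time d a s) c 0 = some (out r D m d z a P) := by
  have hb := (S.cost_bounds (Nat.lt_succ_self s) hs (P (s + 1))).1
  have hbm : 264 ^ 2 ^ (i + 2 + k) ≤ 4 * (P (s + 1)).cost g + 5 := by omega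
  set M := 4 * (P (s + 1)).cost g + 5 with hM
  have hM9 : 9 ≤ M := by
    have : (264 : ℕ) ^ 1 ≤ 264 ^ 2 ^ (i + 2 + k) :=
      Nat.pow_le_pow_right (by norm_num) Nat.one_le_two_pow
    omega
  have hT : 0 < time d a s := Nat.succ_pos _
  have hG : ∀ j, ∃ c, 4 * enc c + 5 ≤ M ^ 2 ^ (r + 1) ∧
      evaln (time d a s) c 0 = some (grp r m d a P j) := by
    intro j
    obtain ⟨c, seed, h1, h2, h3⟩ := S.exists_code_lump hs (min_le_right (j + 1) m)
    obtain ⟨c', h4, h5⟩ := exists_code_dup (r := r) h2 h3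
    refine ⟨comp c' (numCode r seed), ?_,
      evaln_comp_some (evaln_numCode hT (h1.trans_le S.sq_z_le)) h5⟩
    have h6 := enc_numCode_le r seed
    have h7 : (9 : ℕ) ^ 2 ^ r ≤ M ^ 2 ^ r := Nat.pow_le_pow_left hM9 _
    rw [pow_succ 2 r, pow_mul, enc_comp]
    refine four_mul_pair_le' (le_trans ?_ h7) h4 (h6.trans h7)
    have : (9 : ℕ) ^ 1 ≤ 9 ^ 2 ^ r := Nat.pow_le_pow_right (by norm_num) Nat.one_le_two_pow
    omega
  choose C hC1 hC2 using hG
  have hX := Tr.evaln_code hC2 (lab D 0)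
  have hX' := Tr.cost_le hC1 (lab D 0)
  rw [← Tr.enc_code, ← pow_mul, ← pow_add] at hX'
  have hz : 0 < z := by have := S.lt_z; omega
  set h := D + r + (i + 2 + k) + 1 with hh
  have hZ : evaln (time d a s) (comp (powCode h) (numCode r (z - 1))) 0 = some (z ^ 2 ^ h) := by
    have h1 : z - 1 < 2 ^ 2 ^ r := by
      have := S.sq_z_le
      nlinarith [Nat.sub_lt hz one_pos]
    have h2 : z - 1 < time d a s := by
      have h3 := S.z_le
      have h4 := (S.cand s hs.le).sB_eq
      unfold time
      omega
    have := evaln_comp_some (evaln_numCode hT h1) (evaln_powCode h2 h)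
    rwa [Nat.sub_add_cancel hz] at this
  refine ⟨pair _ _, ?_, evaln_pair_some hX hZ⟩
  rw [enc_pair, show D + r + 2 = r + 1 + D + 1 by ring, pow_succ 2 (r + 1 + D), pow_mul]
  refine four_mul_pair_le hX' ?_
  have h1 := enc_powCode_le h
  have h2 := enc_numCode_le r (z - 1)
  have h3 : (9 : ℕ) ^ 2 ^ r ≤ 9 ^ 2 ^ h :=
    Nat.pow_le_pow_right (by norm_num) (Nat.pow_le_pow_right (by norm_num) (by omega))
  rw [enc_comp]
  refine (four_mul_pair_le' (m := 9 ^ 2 ^ h) ?_ h1 (h2.trans h3)).trans ?_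
  · have : (9 : ℕ) ^ 1 ≤ 9 ^ 2 ^ h := Nat.pow_le_pow_right (by norm_num) Nat.one_le_two_pow
    omega
  · calc (9 ^ 2 ^ h) ^ 2 = 81 ^ 2 ^ h := by rw [← pow_mul, mul_comm, pow_mul]; norm_num
      _ ≤ 264 ^ 2 ^ h := Nat.pow_le_pow_left (by norm_num) _
      _ = (264 ^ 2 ^ (i + 2 + k)) ^ 2 ^ (r + 1 + D) := by
        rw [← pow_mul, ← pow_add]; congr 2; omega
      _ ≤ M ^ 2 ^ (r + 1 + D) := Nat.pow_le_pow_left hbm _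

theorem two_mul_enc_le (S : Setup i k r D m d z ρ a g P) {s s' : ℕ} (h : s < s') (hs : s' < m)
    {c c' : Code} (hc : evaln (time d a s) c 0 = some (out r D m d z a P))
    (hc' : 4 * enc c' + 5 ≤ (4 * (P (s' + 1)).cost g + 5) ^ 2 ^ (D + r + 2)) :
    2 * (enc c' + 1) ≤ enc c := by
  have h1 := S.lower (h.trans hs) hc
  have h2 := S.sep (s + 1) (s' + 1) (by omega) hs
  have h3 := (S.cost_bounds (Nat.lt_succ_self s') hs (P (s' + 1))).2
  have h4 := two_mul_pow_le (g := ρ) (by omega) (h3.trans S.ρ_large)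
  have h5 : (4 * (P (s' + 1)).cost g + 5 + ρ) ^ 2 ^ (D + r + 2) ≤
      (4 * (P (s + 1)).cost g) ^ 2 ^ (D + r + 2) :=
    Nat.pow_le_pow_left (by have := S.ρ_pos; omega) _
  omega

theorem strictMono_time (S : Setup i k r D m d z ρ a g P) :
    StrictMono fun s : Fin m => time d a s := by
  intro s s' h
  have h' : (s : ℕ) < s' := h
  have h1 := S.lt_time h'.le s'.2.le
  have h2 := S.time_lt h' s'.2.le
  dsimp only
  exact h2.2.trans (Nat.lt_succ_self _)

theorem strictAnti (S : Setup i k r D m d z ρ a g P) :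
    StrictAnti fun s : Fin m => timeBoundedC (time d a s) (out r D m d z a P) := by
  intro s s' h
  have h' : (s : ℕ) < s' := h
  obtain ⟨c', h1, h2⟩ := S.upper s'.2
  have hle : timeBoundedC (time d a s') (out r D m d z a P) ≤ (codeLength c' : ℕ∞) :=
    sInf_le ⟨c', h2, rfl⟩
  refine hle.trans_lt ?_
  have hlt : (codeLength c' : ℕ∞) < ((codeLength c' + 1 : ℕ) : ℕ∞) := by
    exact_mod_cast Nat.lt_succ_self _
  refine hlt.trans_le (le_sInf ?_)
  rintro _ ⟨c, hc, rfl⟩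
  have h3 := S.two_mul_enc_le h' s'.2 hc h1
  have h4 : Nat.log 2 (enc c') + 1 ≤ Nat.log 2 (enc c) := by
    rcases Nat.eq_zero_or_pos (enc c') with h0 | h0
    · rw [h0, Nat.log_zero_right]
      exact Nat.log_pos (by norm_num) (by omega)
    · rw [← Nat.log_mul_base (by norm_num) h0.ne']
      exact Nat.log_mono_right (by omega)
  have h5 : codeLength c' + 1 ≤ codeLength c := Nat.succ_le_succ h4
  exact_mod_cast h5

end Setup

theorem three_mul_pow_le {z Q : ℕ} (hz : 0 < z) (h : 4 * Q ≤ z) :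
    3 * z ^ Q ≤ 4 * (z - 1) ^ Q := by
  have hz' : (0 : ℝ) < z := by exact_mod_cast hz
  have h1 : (1 : ℝ) ≤ z := by exact_mod_cast hz
  have h2 := one_add_mul_le_pow (a := -(1 / (z : ℝ))) (by
    have : 1 / (z : ℝ) ≤ 1 := by rw [div_le_one hz']; exact h1
    linarith) Q
  have h3 : (4 : ℝ) * Q ≤ z := by exact_mod_cast h
  have h4 : (3 / 4 : ℝ) ≤ 1 + (Q : ℝ) * -(1 / (z : ℝ)) := by
    have : (Q : ℝ) * (1 / (z : ℝ)) ≤ 1 / 4 := by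
      rw [mul_one_div, div_le_iff₀ hz']; linarith
    linarith
  have h5 : ((z - 1 : ℕ) : ℝ) = z * (1 + -(1 / (z : ℝ))) := by
    rw [Nat.cast_sub hz]; field_simp; push_cast; ring
  have h6 : (3 : ℝ) * (z : ℝ) ^ Q ≤ 4 * ((z - 1 : ℕ) : ℝ) ^ Q := by
    rw [h5, mul_pow]
    have : (0 : ℝ) < (z : ℝ) ^ Q := by positivity
    nlinarith [h4.trans h2]
  exact_mod_cast h6

theorem Setup.out_mem {i k r D m d z ρ : ℕ} {a : ℕ → ℕ} {g : Blk i → ℕ} {P : ℕ → Tr (Blk i) k}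
    (S : Setup i k r D m d z ρ a g P) {n : ℕ}
    (h1 : 2 ^ n ≤ z ^ 2 ^ (D + r + (i + 2 + k) + 2))
    (h2 : (z - 1) ^ 2 ^ (D + r + (i + 2 + k) + 2) < 2 ^ n)
    (h3 : 4 * 2 ^ (D + r + (i + 2 + k) + 2) ≤ z) :
    2 ^ n ≤ Setup.out r D m d z a P ∧ Setup.out r D m d z a P < 2 ^ (n + 1) := by
  have hQ : 1 ≤ 2 ^ (D + r + (i + 2 + k) + 2) := Nat.one_le_two_pow
  have h4 := three_mul_pow_le (by omega) h3
  have h5 := S.front_lt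
  have h6 : 4 ≤ z ^ 2 ^ (D + r + (i + 2 + k) + 1) :=
    (show 4 ≤ z by omega).trans (Nat.le_self_pow (by positivity) z)
  have e : ∀ x : ℕ, x ^ 2 ^ (D + r + (i + 2 + k) + 2) = (x ^ 2 ^ (D + r + (i + 2 + k) + 1)) ^ 2 :=
    fun x => by rw [← pow_mul, ← pow_succ]
  rw [e] at h1 h2 h4
  rw [e] at h4
  rw [S.out_eq]
  have h7 := Nat.mul_le_mul_left (z ^ 2 ^ (D + r + (i + 2 + k) + 1)) h6
  rw [← sq] at h7
  rw [pow_succ 2 n]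
  omega

theorem sA_lt_sB_of_lt {d a a' : ℕ} (h : Cand d a) (h' : Cand d a') (hlt : a < a') :
    sA d a' < sB d a + 1 ∧ sB d a + 1 ≤ sB d a' := by
  have e1 := h.sB_eq
  have e2 := h'.sB_eq
  have e3 := h'.sA_eq
  have h5 := h'.add_le
  have h6 := h'.uu_lt
  have h7 := h'.lt_uu
  unfold uu at *
  omega

/-- For all large enough parameters, there are candidates and lumps as needed. -/
theorem exists_setup {i e : ℕ} (he : e ≤ 2 ^ (i + 2))
    (hcard : 4 * Fintype.card (Blk i) ≤ 264 ^ e) :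
    ∃ C E : ℕ, 0 < C ∧ 0 < E ∧ ∀ k r D m d z ρ : ℕ, 0 < m → 2 * (C * m) ^ E + 10 ≤ d →
      (∀ (c : Code) (t y : ℕ), evaln t c 0 = some y →
        (fun y => (Nat.unpair y).1)^[i + 2 + k] y = d →
        ∀ e, 4 * e + 5 ≤ 269 ^ 2 ^ (i + 2 + k) → psi e ≤ enc c) →
      ww d + 1 ≤ z → z ≤ ww d ^ 2 → z ^ 2 ≤ 2 ^ 2 ^ r → m ≤ 2 ^ D → 1 ≤ ρ →
      269 ^ 2 ^ (i + 2 + k) ≤ 2 ^ (D + r + 2) * ρ →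
      m ^ 2 ^ (i + 2) * ((4 ^ k * Fintype.card (Blk i)) ^ 2 ^ (i + 2) * ρ ^ e) <
        (Fintype.card (Blk i) ^ 2 ^ k) ^ 2 ^ (i + 2) →
      ∃ a g P, Setup i k r D m d z ρ a g P := by
  obtain ⟨C, E, hC, hE, H⟩ := exists_same_function (Blk i) (269 ^ 2 ^ (i + 2))
  refine ⟨C, E, hC, hE, fun k r D m d z ρ hm hd hav hz1 hz2 hz3 hmD hρ hρ' hlt => ?_⟩
  have hcand : ∀ j < (C * m) ^ E, Cand d (2 * j + 4) := fun j hj => ⟨by omega, by omega⟩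
  have htime : ∀ s j, s < j → j < (C * m) ^ E →
      sA d (2 * j + 4) < sB d (2 * s + 4) + 1 ∧ sB d (2 * s + 4) + 1 < sB d (2 * j + 4) := by
    intro s j hsj hj
    have h1 := sA_lt_sB_of_lt (hcand s (by omega)) (hcand j hj) (by omega)
    have e1 := (hcand s (by omega)).sB_eq
    have e2 := (hcand j hj).sB_eq
    unfold uu at e1 e2
    omega
  obtain ⟨ε, g, h1, h2, h3⟩ := H m hm
    (fun j s B => kap d (2 * j + 4) (sB d (2 * s + 4) + 1) B)
    (fun s s' j B hs hj hjm => (hcand j hjm).kap_anti (htime s j (by omega) hjm).1 (by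
      have e1 := (hcand s (by omega)).sB_eq
      have e2 := (hcand s' (by omega)).sB_eq
      unfold uu at e1 e2
      omega) B)
    (fun s j B hsj hj => by
      have := (hcand j hj).four_mul_kap_le (htime s j hsj hj).1 B
      omega)
  have hg := h3 0 1 one_pos hm
  have hlt1 := h1 0 1 one_pos hm
  have ht1 := htime _ _ hlt1 (h2 1 hm)
  have hc1 := hcand _ (h2 1 hm)
  have hinj : Function.Injective g := by
    rw [← hg]; exact hc1.kap_injective ht1.1
  have hlow : ∀ B, 264 ^ 2 ^ (i + 2) ≤ 4 * g B := by
    rw [← hg]; exact hc1.le_four_mul_kap ht1.1 ht1.2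
  have hsp := Tr.sparse_cost hinj he (by norm_num) hlow hcard k
  obtain ⟨P, hP⟩ := hsp.exists_separated (by positivity) m ρ hρ (by rwa [Tr.card])
  exact ⟨fun j => 2 * ε j + 4, g, P,
    { cand := fun j hj => hcand _ (h2 j hj)
      gap := fun s j hsj hj => by have := h1 s j hsj hj; omega
      kap_eq := h3
      avoid := hav
      lt_z := hz1
      z_le := hz2
      sq_z_le := hz3
      m_le := hmD
      ρ_pos := hρ
      sep := hP
      ρ_large := hρ' }⟩

open Filter in
theorem eventually_mul_log_pow_le (c e : ℕ) :
    ∃ n₀, ∀ n, n₀ ≤ n → c * (Nat.log 2 n + 1) ^ e ≤ n := by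
  have h1 := tendsto_pow_const_div_const_pow_of_one_lt e (one_lt_two (α := ℝ))
  have h2 := (tendsto_order.1 h1).2 (1 / (2 * (c + 1 : ℝ))) (by positivity)
  obtain ⟨l₀, hl⟩ := eventually_atTop.1 h2
  refine ⟨2 ^ l₀, fun n hn => ?_⟩
  have hn0 : n ≠ 0 := by have := Nat.one_le_two_pow (n := l₀); omega
  have hlog : l₀ ≤ Nat.log 2 n := Nat.le_log_of_pow_le (by norm_num) hn
  have h3 := hl (Nat.log 2 n + 1) (by omega)
  have h4 : 2 ^ Nat.log 2 n ≤ n := Nat.pow_log_le_self 2 hn0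
  rw [div_lt_div_iff₀ (by positivity) (by positivity), one_mul] at h3
  have h5 : (Nat.log 2 n + 1) ^ e * (2 * (c + 1)) < 2 ^ (Nat.log 2 n + 1) := by
    exact_mod_cast h3
  rw [pow_succ 2] at h5
  nlinarith [Nat.zero_le ((Nat.log 2 n + 1) ^ e)]

theorem exists_pow_two_pow_between {h n : ℕ} (h1 : 1 < h) (hn : h ≤ n) :
    ∃ k, n ≤ h ^ 2 ^ k ∧ h ^ 2 ^ k ≤ n ^ 2 := by
  have hex : ∃ k, n ≤ h ^ 2 ^ k :=
    ⟨n, (Nat.lt_two_pow_self.le).trans ((Nat.lt_pow_self h1).le)⟩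
  refine ⟨Nat.find hex, Nat.find_spec hex, ?_⟩
  rcases hk : Nat.find hex with _ | k
  · rw [pow_zero, pow_one]
    exact hn.trans (Nat.le_self_pow two_ne_zero n)
  · have := Nat.find_min hex (m := k) (by omega)
    rw [pow_succ 2 k, pow_mul]
    exact Nat.pow_le_pow_left (by omega) 2

theorem exists_root {n Q : ℕ} (hQ : Q ≠ 0) :
    ∃ z, 1 ≤ z ∧ 2 ^ n ≤ z ^ Q ∧ (z - 1) ^ Q < 2 ^ n := by
  have hex : ∃ z, 2 ^ n ≤ z ^ Q := ⟨2 ^ n, Nat.le_self_pow hQ _⟩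
  have hz : Nat.find hex ≠ 0 := by
    intro h
    have h1 := Nat.find_spec hex
    rw [h, zero_pow hQ] at h1
    have := Nat.one_le_two_pow (n := n)
    omega
  exact ⟨Nat.find hex, by omega, Nat.find_spec hex,
    not_le.1 (Nat.find_min hex (m := Nat.find hex - 1) (by omega))⟩

theorem exists_params (i B : ℕ) (hB : 2 ≤ B) : ∃ n₀, ∀ n, n₀ ≤ n → ∃ k r D z : ℕ,
    n ≤ 269 ^ 2 ^ (i + 2 + k) ∧ 269 ^ 2 ^ (i + 2 + k) ≤ n ^ 2 ∧
    2 ^ n ≤ z ^ 2 ^ (D + r + (i + 2 + k) + 2) ∧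
    (z - 1) ^ 2 ^ (D + r + (i + 2 + k) + 2) < 2 ^ n ∧
    4 * 2 ^ (D + r + (i + 2 + k) + 2) ≤ z ∧
    z ^ 2 ≤ 2 ^ 2 ^ r ∧ n ^ B ≤ z ∧ Nat.sqrt n ≤ 2 ^ D ∧ 2 ^ k ≤ Nat.log 2 n + 1 ∧
    n < 2 * (B + 1) * (Nat.log 2 n + 1) ^ 2 * 2 ^ (D + r + 2) ∧ 2 ^ (D + r + 2) ≤ n := by
  obtain ⟨n₁, hn₁⟩ := eventually_mul_log_pow_le (256 * (B + 1) ^ 4) 6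
  refine ⟨max n₁ (269 ^ 2 ^ (i + 2)), fun n hn => ?_⟩
  have hlog := hn₁ n ((le_max_left _ _).trans hn)
  have hn2 := (le_max_right _ _).trans hn
  have h269 : 269 ≤ 269 ^ 2 ^ (i + 2) := Nat.le_self_pow (by positivity) _
  obtain ⟨k, hk1, hk2⟩ := exists_pow_two_pow_between (by omega) hn2
  rw [← pow_mul, ← pow_add] at hk1 hk2
  have hΛ : n < 2 ^ (Nat.log 2 n + 1) := Nat.lt_pow_succ_log_self (by norm_num) n
  set Λ := Nat.log 2 n + 1 with hΛ'
  have hΛ1 : 1 ≤ Λ := by omega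
  clear_value Λ
  have hK : 4 * 2 ^ (i + 2 + k) < Λ := by
    have h1 : (2 : ℕ) ^ (8 * 2 ^ (i + 2 + k)) < 2 ^ (2 * Λ) := by
      calc (2 : ℕ) ^ (8 * 2 ^ (i + 2 + k)) = 256 ^ 2 ^ (i + 2 + k) := by rw [pow_mul]; norm_num
        _ ≤ 269 ^ 2 ^ (i + 2 + k) := Nat.pow_le_pow_left (by norm_num) _
        _ ≤ n ^ 2 := hk2
        _ < (2 ^ Λ) ^ 2 := Nat.pow_lt_pow_left hΛ two_ne_zero
        _ = 2 ^ (2 * Λ) := by rw [← pow_mul, mul_comm]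
    have := (Nat.pow_lt_pow_iff_right (by norm_num)).1 h1
    omega
  set β := (B + 1) * Λ with hβ
  have hβ1 : 1 ≤ β := Nat.mul_pos (by omega) hΛ1
  set T := 16 * β ^ 2 * Λ with hT
  have hTβ : T = 2 * β * (8 * β * Λ) := by rw [hT]; ring
  have hTT : T ^ 2 ≤ n := by
    calc T ^ 2 = 256 * (B + 1) ^ 4 * Λ ^ 6 := by rw [hT, hβ]; ring
      _ ≤ n := hlog
  have hT1 : 1 ≤ T := by
    rw [hT]
    exact Nat.mul_pos (Nat.mul_pos (by norm_num) (Nat.pow_pos hβ1)) hΛ1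
  have hTn : T ≤ n := (Nat.le_self_pow two_ne_zero T).trans hTT
  have hβT : β ≤ T := by
    rw [hT]; nlinarith [Nat.mul_le_mul hβ1 hΛ1, Nat.mul_le_mul hβ1 hβ1]
  have hnβ : n / β ≠ 0 := (Nat.div_pos (hβT.trans hTn) hβ1).ne'
  set H := Nat.log 2 (n / β) with hH
  have hH1 : β * 2 ^ H ≤ n := by
    have := Nat.pow_log_le_self 2 hnβ
    calc β * 2 ^ H ≤ β * (n / β) := Nat.mul_le_mul_left _ this
      _ ≤ n := Nat.mul_div_le n β
  have hH2 : n < 2 * β * 2 ^ H := by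
    have h1 := Nat.lt_pow_succ_log_self (b := 2) (by norm_num) (n / β)
    rw [Nat.div_lt_iff_lt_mul hβ1, Nat.succ_eq_add_one, pow_succ] at h1
    calc n < _ := h1
      _ = _ := by ring
  clear_value H
  obtain ⟨z, hz1, hz2, hz3⟩ := exists_root (n := n) (Q := 2 ^ H) (by positivity)
  have hz4 : 2 ^ (β - 1) < z := by
    by_contra! h
    have h1 := hz2.trans (Nat.pow_le_pow_left h (2 ^ H))
    rw [← pow_mul, Nat.pow_le_pow_iff_right (by norm_num)] at h1
    have h2 : (β - 1) * 2 ^ H < β * 2 ^ H := Nat.mul_lt_mul_of_pos_right (by omega) (by positivity)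
    omega
  have hz5 : z ≤ 2 ^ (2 * β) := by
    by_contra! h
    have h1 := (Nat.pow_le_pow_left (show 2 ^ (2 * β) ≤ z - 1 by omega) (2 ^ H)).trans_lt hz3
    rw [← pow_mul, Nat.pow_lt_pow_iff_right (by norm_num)] at h1
    omega
  have hz6 : n ^ B ≤ z := by
    calc n ^ B ≤ (2 ^ Λ) ^ B := Nat.pow_le_pow_left hΛ.le B
      _ = 2 ^ (B * Λ) := by rw [← pow_mul, mul_comm]
      _ ≤ 2 ^ (β - 1) := Nat.pow_le_pow_right (by norm_num) (by rw [hβ, add_mul]; omega)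
      _ ≤ z := hz4.le
  set r := Nat.clog 2 (4 * β) with hr
  have hr1 : 4 * β ≤ 2 ^ r := Nat.le_pow_clog (by norm_num) _
  have hr2 : 2 ^ r ≤ 8 * β := by
    have h1 := Nat.pow_pred_clog_lt_self (b := 2) (by norm_num) (x := 4 * β) (by omega)
    have h2 : r ≠ 0 := by
      intro h
      rw [h, pow_zero] at hr1
      omega
    obtain ⟨r', h3⟩ := Nat.exists_eq_succ_of_ne_zero h2
    rw [← hr, h3] at h1
    rw [h3, Nat.succ_eq_add_one, pow_succ]
    rw [Nat.pred_succ] at h1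
    omega
  clear_value r
  have hrK : 2 ^ (r + (i + 2 + k) + 2) ≤ 8 * β * Λ := by
    calc 2 ^ (r + (i + 2 + k) + 2) = 2 ^ r * (4 * 2 ^ (i + 2 + k)) := by ring
      _ ≤ 8 * β * Λ := Nat.mul_le_mul hr2 hK.le
  have hHr : r + (i + 2 + k) + 2 ≤ H := by
    rw [← Nat.pow_le_pow_iff_right (a := 2) (by norm_num)]
    refine hrK.trans ?_
    by_contra! h
    have h1 : 2 * β * 2 ^ H ≤ 2 * β * (8 * β * Λ) := Nat.mul_le_mul_left _ h.le
    have h2 : 2 * β * (8 * β * Λ) = T := hTβ.symm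
    omega
  obtain ⟨D, hD⟩ := Nat.exists_eq_add_of_le hHr
  have eH : H = D + r + (i + 2 + k) + 2 := by omega
  have hD1 : n < T * 2 ^ D := by
    calc n < 2 * β * 2 ^ H := hH2
      _ = 2 * β * (2 ^ (r + (i + 2 + k) + 2) * 2 ^ D) := by rw [← pow_add, ← hD]
      _ ≤ 2 * β * (8 * β * Λ * 2 ^ D) := by gcongr
      _ = T * 2 ^ D := by rw [hTβ]; ring
  have hq : 2 ^ H = 2 ^ (i + 2 + k) * 2 ^ (D + r + 2) := by
    rw [eH, ← pow_add]; congr 1; omega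
  rw [eH] at hz2 hz3
  refine ⟨k, r, D, z, hk1, hk2, hz2, hz3, ?_, ?_, hz6, ?_, ?_, ?_, ?_⟩
  · rw [← eH]
    have h1 : n ^ 2 ≤ n ^ B := Nat.pow_le_pow_right (by omega) hB
    have h2 : 2 ^ H ≤ β * 2 ^ H := Nat.le_mul_of_pos_left _ hβ1
    have h3 : 4 * n ≤ n ^ 2 := by rw [sq]; exact Nat.mul_le_mul_right n (by omega)
    omega
  · calc z ^ 2 ≤ (2 ^ (2 * β)) ^ 2 := Nat.pow_le_pow_left hz5 2
      _ = 2 ^ (4 * β) := by rw [← pow_mul]; congr 1; ring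
      _ ≤ 2 ^ 2 ^ r := Nat.pow_le_pow_right (by norm_num) hr1
  · by_contra! h
    have h1 := Nat.sqrt_le n
    have h2 : n < T * Nat.sqrt n := hD1.trans_le (Nat.mul_le_mul_left _ h.le)
    have h3 : Nat.sqrt n < T := by
      by_contra! h3
      have := Nat.mul_le_mul_right (Nat.sqrt n) h3
      omega
    have := Nat.mul_le_mul_left T h3.le
    rw [← sq] at this
    omega
  · have : 2 ^ k ≤ 2 ^ (i + 2 + k) := Nat.pow_le_pow_right (by norm_num) (by omega)
    omega
  · calc n < 2 * β * 2 ^ H := hH2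
      _ = 2 * β * (2 ^ (i + 2 + k) * 2 ^ (D + r + 2)) := by rw [hq]
      _ ≤ 2 * β * (Λ * 2 ^ (D + r + 2)) := by gcongr; omega
      _ = _ := by rw [hβ]; ring
  · have h1 : 1 ≤ 2 ^ (i + 2 + k) := Nat.one_le_two_pow
    have h2 : 2 ^ H ≤ β * 2 ^ H := Nat.le_mul_of_pos_left _ hβ1
    have h3 : 2 ^ (D + r + 2) ≤ 2 ^ H := by rw [hq]; exact Nat.le_mul_of_pos_left _ h1
    omega

theorem count_lt {i k m n N q Λ c e f : ℕ} (hn1 : n ≤ 269 ^ 2 ^ (i + 2 + k))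
    (hn2 : 269 ^ 2 ^ (i + 2 + k) ≤ n ^ 2) (hq0 : 0 < q) (hqn : q ≤ n) (hm : m ^ 2 ≤ n)
    (hk : 2 ^ k ≤ Λ) (hq : n < c * Λ ^ 2 * q) (hN : 269 ^ f ≤ N) (he : e = f + 7)
    (hP : 2 ^ (i + 1) + 15 ≤ e)
    (hlarge : N ^ 2 ^ (i + 2) * 2 ^ e * c ^ e * Λ ^ (2 * 2 ^ (i + 2) + 2 * e) ≤ n) :
    m ^ 2 ^ (i + 2) * ((4 ^ k * N) ^ 2 ^ (i + 2) *
      (269 ^ 2 ^ (i + 2 + k) / q + 1) ^ e) < (N ^ 2 ^ k) ^ 2 ^ (i + 2) := by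
  have hh : (269 ^ 2 ^ (i + 2 + k)) ^ f ≤ (N ^ 2 ^ k) ^ 2 ^ (i + 2) := by
    calc (269 ^ 2 ^ (i + 2 + k)) ^ f = ((269 ^ f) ^ 2 ^ k) ^ 2 ^ (i + 2) := by
          simp only [← pow_mul, pow_add]; congr 1; ring
      _ ≤ _ := by gcongr
  have hpp : 2 ^ (i + 2) = 2 * 2 ^ (i + 1) := by ring
  generalize (N ^ 2 ^ k) ^ 2 ^ (i + 2) = R at *
  generalize 269 ^ 2 ^ (i + 2 + k) = h at *
  rw [hpp] at hlarge ⊢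
  clear hpp
  generalize 2 ^ (i + 1) = p at *
  have hn0 : 0 < n := by omega
  have hρ : q * (h / q + 1) ≤ 2 * h := by
    have := Nat.mul_div_le h q
    rw [mul_add]; omega
  generalize h / q + 1 = ρ at *
  have h4 : 4 ^ k ≤ Λ ^ 2 := by
    calc 4 ^ k = (2 ^ k) ^ 2 := by rw [← pow_mul, mul_comm, pow_mul]; norm_num
      _ ≤ Λ ^ 2 := Nat.pow_le_pow_left hk 2
  have hΛ0 : 0 < Λ := lt_of_lt_of_le (by positivity) hk
  have hc0 : 0 < c := by
    rcases Nat.eq_zero_or_pos c with rfl | h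
    · simp at hq
    · exact h
  refine lt_of_mul_lt_mul_right (a := (c * Λ ^ 2 * q) ^ e) ?_ (Nat.zero_le _)
  calc m ^ (2 * p) * ((4 ^ k * N) ^ (2 * p) * ρ ^ e) * (c * Λ ^ 2 * q) ^ e
      = (m ^ 2) ^ p * (4 ^ k * N) ^ (2 * p) * (q * ρ) ^ e * (c * Λ ^ 2) ^ e := by
        rw [mul_pow _ q, mul_pow q ρ, pow_mul m]; ring
    _ ≤ n ^ p * (Λ ^ 2 * N) ^ (2 * p) * (2 * h) ^ e * (c * Λ ^ 2) ^ e := by gcongr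
    _ = n ^ p * (N ^ (2 * p) * 2 ^ e * c ^ e * Λ ^ (2 * (2 * p) + 2 * e)) * (h ^ 7 * h ^ f) := by
        rw [mul_pow (Λ ^ 2), mul_pow 2 h, mul_pow c, ← pow_mul, ← pow_mul, pow_add Λ, ← pow_add h,
          add_comm 7 f, ← he]
        ring
    _ ≤ n ^ p * n * ((n ^ 2) ^ 7 * h ^ f) := by gcongr
    _ = n ^ (p + 15) * h ^ f := by ring
    _ ≤ n ^ e * h ^ f := Nat.mul_le_mul_right _ (Nat.pow_le_pow_right hn0 hP)
    _ < (c * Λ ^ 2 * q) ^ e * h ^ f :=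
        Nat.mul_lt_mul_of_pos_right (Nat.pow_lt_pow_left hq (by omega))
          (pow_pos (hn0.trans_le hn1) f)
    _ ≤ (c * Λ ^ 2 * q) ^ e * R := Nat.mul_le_mul_left _ hh
    _ = R * (c * Λ ^ 2 * q) ^ e := mul_comm _ _

set_option exponentiation.threshold 3000 in
theorem four_mul_card_blk_le : 4 * Fintype.card (Blk 9) ≤ 264 ^ 1042 := by
  rw [Blk.card]; norm_num

set_option exponentiation.threshold 3000 in
theorem le_card_blk : 269 ^ 1035 ≤ Fintype.card (Blk 9) := by
  rw [Blk.card]; norm_num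

/-- A suitable `d` just below the square root of `z`. -/
theorem exists_dim (K : ℕ) {z N L : ℕ} (hz : (2 * N + L + 11) ^ 2 ≤ z) :
    ∃ d, L ≤ d ∧ ww d + 1 ≤ z ∧ z ≤ ww d ^ 2 ∧
      ∀ c : Code, enc c < N → ∀ t y, evaln t c 0 = some y →
        (fun y => (Nat.unpair y).1)^[K] y ≠ d := by
  have h1 : 2 * N + L + 11 ≤ Nat.sqrt z := by rw [Nat.le_sqrt']; exact hz
  have h2 := Nat.sqrt_le' z
  have h3 := Nat.lt_succ_sqrt' z
  rw [Nat.succ_eq_add_one] at h3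
  obtain ⟨d, hd1, hd2, hd3⟩ := exists_avoiding K (Nat.sqrt z - N - 3) N
  generalize Nat.sqrt z = s at *
  refine ⟨d, by omega, ?_, ?_, hd3⟩
  · have : (d + 3) ^ 2 ≤ s ^ 2 := Nat.pow_le_pow_left (by omega) 2
    unfold ww
    nlinarith
  · have h4 : s + 1 ≤ ww d := by
      have h5 : s ≤ 2 * d := by omega
      have h6 : 5 * d ≤ d ^ 2 := by rw [sq]; exact Nat.mul_le_mul_right d (by omega)
      unfold ww
      omega
    exact h3.le.trans (Nat.pow_le_pow_left h4 2)

theorem dim_bound {n b C E m z : ℕ} (hn : 60 ≤ n) (hC : C ^ E ≤ n) (hm : m ≤ n)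
    (hb : b = 2 * (E + 6)) (hz : n ^ b ≤ z) :
    (2 * (4 * n ^ 4 + 4) + (2 * (C * m) ^ E + 10) + 11) ^ 2 ≤ z := by
  refine le_trans ?_ hz
  rw [hb, show n ^ (2 * (E + 6)) = (n ^ (E + 6)) ^ 2 by rw [← pow_mul, mul_comm]]
  refine Nat.pow_le_pow_left ?_ 2
  have h1 : (C * m) ^ E ≤ n ^ (E + 5) := by
    rw [mul_pow]
    calc C ^ E * m ^ E ≤ n * n ^ E := Nat.mul_le_mul hC (Nat.pow_le_pow_left hm E)
      _ = n ^ (E + 1) := by ring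
      _ ≤ n ^ (E + 5) := Nat.pow_le_pow_right (by omega) (by omega)
  have h2 : n ^ 4 ≤ n ^ (E + 5) := Nat.pow_le_pow_right (by omega) (by omega)
  have h3 : 1 ≤ n ^ (E + 5) := Nat.one_le_pow _ _ (by omega)
  have h4 : 60 * n ^ (E + 5) ≤ n ^ (E + 6) := by
    rw [pow_succ' n (E + 5)]; exact Nat.mul_le_mul_right _ hn
  omega

theorem exists_setup_of_large {i e f : ℕ} (he : e = f + 7) (hep : e ≤ 2 ^ (i + 2))
    (hP : 2 ^ (i + 1) + 15 ≤ e) (hcard : 4 * Fintype.card (Blk i) ≤ 264 ^ e)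
    (hcard' : 269 ^ f ≤ Fintype.card (Blk i)) :
    ∃ n₀, ∀ n, n₀ ≤ n → ∃ k r D d z ρ a g P,
      Setup (i := i) (k := k) r D (Nat.sqrt n / 2) d z ρ a g P ∧
      2 ^ n ≤ Setup.out r D (Nat.sqrt n / 2) d z a P ∧
      Setup.out r D (Nat.sqrt n / 2) d z a P < 2 ^ (n + 1) := by
  obtain ⟨C, E, hC, hE, H⟩ := exists_setup hep hcard
  obtain ⟨n₁, hn₁⟩ := exists_params i (2 * (E + 6)) (by omega)
  obtain ⟨n₂, hn₂⟩ := eventually_mul_log_pow_le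
    (Fintype.card (Blk i) ^ 2 ^ (i + 2) * 2 ^ e * (2 * (2 * (E + 6) + 1)) ^ e)
    (2 * 2 ^ (i + 2) + 2 * e)
  refine ⟨n₁ + n₂ + C ^ E + 60, fun n hn => ?_⟩
  obtain ⟨k, r, D, z, p1, p2, p3, p4, p5, p6, p7, p8, p9, p10, p11⟩ := hn₁ n (by omega)
  have hlarge := hn₂ n (by omega)
  have hs := Nat.sqrt_le' n
  have hs7 : 7 ≤ Nat.sqrt n := by rw [Nat.le_sqrt']; omega
  have hsn : Nat.sqrt n ≤ n := Nat.sqrt_le_self n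
  have hm2 : (Nat.sqrt n / 2) ^ 2 ≤ n :=
    (Nat.pow_le_pow_left (Nat.div_le_self _ _) 2).trans hs
  have hq0 : 0 < 2 ^ (D + r + 2) := by positivity
  generalize hm : Nat.sqrt n / 2 = m at *
  obtain ⟨d, d1, d2, d3, d4⟩ := exists_dim (i + 2 + k)
    (dim_bound (show 60 ≤ n by omega) (show C ^ E ≤ n by omega) (show m ≤ n by omega) rfl p7)
  have hlt := count_lt p1 p2 hq0 p11 hm2 p9 p10 hcard' he hP hlarge
  obtain ⟨a, g, P, S⟩ := H k r D m d z (269 ^ 2 ^ (i + 2 + k) / 2 ^ (D + r + 2) + 1) (by omega) d1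
    (fun c t y h1 h2 e' he' => by
      by_contra! h3
      refine d4 c (h3.trans_le ?_) t y h1 h2
      have h4 : e' ≤ n ^ 2 := by omega
      have h5 := Nat.pow_le_pow_left h4 2
      rw [← pow_mul] at h5
      norm_num at h5
      unfold psi
      omega)
    d2 d3 p6 (by omega) (Nat.le_add_left 1 _)
    (by rw [mul_add, mul_one]; exact (Nat.lt_mul_div_succ _ hq0).le) hlt
  exact ⟨k, r, D, d, z, _, a, g, P, S, S.out_mem p3 p4 p5⟩

end TimeBounded

/-- Time-bounded incompressibility hierarchy: for every large enough `n` there are a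
binary string `x` of length `n` (identified with a natural number in `[2^n, 2^(n+1))`)
and a strictly increasing sequence of `m = ⌊√n / 2⌋` time bounds `t 0 < t 1 < … < t (m-1)`
along which the time-bounded Kolmogorov complexities strictly decrease:
`C^{t 0}(x) > C^{t 1}(x) > … > C^{t (m-1)}(x)`. -/
theorem timeBounded_incompressibility_hierarchy :
    ∃ n₀ : ℕ, ∀ n : ℕ, n₀ ≤ n →
      ∃ x : ℕ, 2 ^ n ≤ x ∧ x < 2 ^ (n + 1) ∧
        ∃ t : Fin (Nat.sqrt n / 2) → ℕ,
          StrictMono t ∧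
          StrictAnti fun i : Fin (Nat.sqrt n / 2) => timeBoundedC (t i) x := by
  obtain ⟨n₀, h⟩ := TimeBounded.exists_setup_of_large (i := 9) (e := 1042) (f := 1035) rfl
    (by norm_num) (by norm_num) TimeBounded.four_mul_card_blk_le TimeBounded.le_card_blk
  refine ⟨n₀, fun n hn => ?_⟩
  obtain ⟨k, r, D, d, z, ρ, a, g, P, S, h1, h2⟩ := h n hn
  exact ⟨_, h1, h2, _, S.strictMono_time, S.strictAnti⟩
end
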